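/- arXiv:solv-int/9805005 — 12 statements merged into one kernel-verified Lean document; each statement's English description precedes it below -/
import Mathlib

section
/- Let β_ij : U → ℝ (i ≠ j) be smooth functions on a nonempty open connected set U ⊆ ℝ^N, let ξ_i : U → ℝ^M be an X-solution for β, and let L be a constant real M×M matrix such that the family ξ*_i := ξ_iᵀ L is an H-solution for β. Then for every u ∈ U and every pair i ≠ j such that Lᵀ ξ_i(u) ≠ 0, the symmetry β_ij(u) = β_ji(u) holds. -/
open Matrix Finset

/-- Partial derivative of a scalar function on `ℝ^N` in the `i`-th coordinate direction. -/
noncomputable def pd {N : ℕ} (i : Fin N) (f : (Fin N → ℝ) → ℝ) (u : Fin N → ℝ) : ℝ :=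
  fderiv ℝ f u (Pi.single i 1)

/-- Partial differentiation commutes with right multiplication by a constant matrix. -/
theorem pd_vecMul {N M K : ℕ} (i : Fin N) (f : (Fin N → ℝ) → Fin M → ℝ)
    (L : Matrix (Fin M) (Fin K) ℝ) (u : Fin N → ℝ)
    (hf : ∀ a, DifferentiableAt ℝ (fun v => f v a) u) (b : Fin K) :
    pd i (fun v => (f v ᵥ* L) b) u = ((fun a => pd i (fun v => f v a) u) ᵥ* L) b := by
  have h : HasFDerivAt (fun v => ∑ a, f v a * L a b)
      (∑ a, L a b • fderiv ℝ (fun v => f v a) u) u :=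
    HasFDerivAt.fun_sum fun a _ => (hf a).hasFDerivAt.mul_const (L a b)
  simp only [pd, vecMul, dotProduct, h.fderiv, _root_.sum_apply, _root_.smul_apply,
    smul_eq_mul]
  exact Finset.sum_congr rfl fun a _ => mul_comm _ _

/-- If `ξ` is an X-solution for `β` and `ξ*_i := ξ_iᵀ L` is an H-solution for `β`,
then at each point `u ∈ U` and pair `i ≠ j` with `Lᵀ ξ_i(u) ≠ 0`, we have `β_ij(u) = β_ji(u)`. -/
theorem stmt_1 {N M : ℕ} (hN : 2 ≤ N)
    (U : Set (Fin N → ℝ)) (hUopen : IsOpen U) (hUconn : IsConnected U)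
    (β : Fin N → Fin N → (Fin N → ℝ) → ℝ)
    (hβsmooth : ∀ i j : Fin N, i ≠ j → ContDiffOn ℝ (⊤ : ℕ∞) (β i j) U)
    (ξ : Fin N → (Fin N → ℝ) → Fin M → ℝ)
    (hξsmooth : ∀ (j : Fin N) (a : Fin M), ContDiffOn ℝ (⊤ : ℕ∞) (fun u => ξ j u a) U)
    (hξX : ∀ i j : Fin N, i ≠ j → ∀ u ∈ U, ∀ a : Fin M,
      pd i (fun v => ξ j v a) u = β j i u * ξ i u a)
    (L : Matrix (Fin M) (Fin M) ℝ)
    (hξsH : ∀ i j : Fin N, i ≠ j → ∀ u ∈ U, ∀ b : Fin M,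
      pd i (fun v => (ξ j v ᵥ* L) b) u = β i j u * (ξ i u ᵥ* L) b) :
    ∀ u ∈ U, ∀ i j : Fin N, i ≠ j → ξ i u ᵥ* L ≠ 0 → β i j u = β j i u := by
  intro u hu i j hij hne
  obtain ⟨b, hb⟩ := Function.ne_iff.mp hne
  have hdiff (a : Fin M) : DifferentiableAt ℝ (fun v => ξ j v a) u :=
    ((hξsmooth j a).contDiffAt (hUopen.mem_nhds hu)).differentiableAt (by simp)
  have hX : (fun a => pd i (fun v => ξ j v a) u) = β j i u • ξ i u :=
    funext fun a => hξX i j hij u hu a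
  have h := pd_vecMul i (ξ j) L u hdiff b
  rw [hξsH i j hij u hu b, hX, smul_vecMul] at h
  exact mul_right_cancel₀ hb h
end

section
/- Let β_ij : U → ℝ (i ≠ j) be smooth functions on a nonempty open connected set U ⊆ ℝ^N satisfying β_ij = β_ji for all i ≠ j. Let ξ_i : U → ℝ^M and ζ_i : U → ℝ^{M'} be X-solutions for β, let L be an M×M matrix and K an M'×M' matrix, and set ξ*_i := ξ_iᵀ L and ζ*_i := ζ_iᵀ K (which are H-solutions). Let Ω(ξ,ζ*) and Ω(ζ,ξ*) be potentials for the pairs (ξ,ζ*) and (ζ,ξ*) respectively. Then for every i = 1,…,N, ∂_i ( Lᵀ Ω(ξ,ζ*) − Ω(ζ,ξ*)ᵀ K ) = 0, so Lᵀ Ω(ξ,ζ*) − Ω(ζ,ξ*)ᵀ K is a constant matrix on U. -/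
open Matrix Finset

/-- A function whose partial derivatives all vanish at a point has zero derivative there. -/
theorem fderiv_eq_zero_of_pd_eq_zero {N : ℕ} {f : (Fin N → ℝ) → ℝ} {u : Fin N → ℝ}
    (h : ∀ i, pd i f u = 0) : fderiv ℝ f u = 0 := by
  refine ContinuousLinearMap.coe_injective ((Pi.basisFun ℝ (Fin N)).ext fun i => ?_)
  simpa [pd] using h i

/-- For symmetric `β`, X-solutions `ξ`, `ζ`, the H-solutions `ξ* = ξᵀL`,
`ζ* = ζᵀK` and potentials `Ω(ξ,ζ*)`, `Ω(ζ,ξ*)`, the matrix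
`Lᵀ Ω(ξ,ζ*) − Ω(ζ,ξ*)ᵀ K` has vanishing partial derivatives, hence is constant on `U`. -/
theorem stmt_2 {N M M' : ℕ} (hN : 2 ≤ N)
    (U : Set (Fin N → ℝ)) (hUopen : IsOpen U) (hUconn : IsConnected U)
    (β : Fin N → Fin N → (Fin N → ℝ) → ℝ)
    (hβsmooth : ∀ i j : Fin N, i ≠ j → ContDiffOn ℝ (⊤ : ℕ∞) (β i j) U)
    (hβsym : ∀ i j : Fin N, i ≠ j → ∀ u ∈ U, β i j u = β j i u)
    (ξ : Fin N → (Fin N → ℝ) → Fin M → ℝ)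
    (hξsmooth : ∀ (j : Fin N) (a : Fin M), ContDiffOn ℝ (⊤ : ℕ∞) (fun u => ξ j u a) U)
    (hξX : ∀ i j : Fin N, i ≠ j → ∀ u ∈ U, ∀ a : Fin M,
      pd i (fun v => ξ j v a) u = β j i u * ξ i u a)
    (ζ : Fin N → (Fin N → ℝ) → Fin M' → ℝ)
    (hζsmooth : ∀ (j : Fin N) (a : Fin M'), ContDiffOn ℝ (⊤ : ℕ∞) (fun u => ζ j u a) U)
    (hζX : ∀ i j : Fin N, i ≠ j → ∀ u ∈ U, ∀ a : Fin M',
      pd i (fun v => ζ j v a) u = β j i u * ζ i u a)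
    (L : Matrix (Fin M) (Fin M) ℝ) (K : Matrix (Fin M') (Fin M') ℝ)
    (Ωξζ : (Fin N → ℝ) → Matrix (Fin M) (Fin M') ℝ)
    (hΩξζsmooth : ∀ (a : Fin M) (b : Fin M'), ContDiffOn ℝ (⊤ : ℕ∞) (fun u => Ωξζ u a b) U)
    (hΩξζ : ∀ i : Fin N, ∀ u ∈ U, ∀ (a : Fin M) (b : Fin M'),
      pd i (fun v => Ωξζ v a b) u = ξ i u a * (ζ i u ᵥ* K) b)
    (Ωζξ : (Fin N → ℝ) → Matrix (Fin M') (Fin M) ℝ)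
    (hΩζξsmooth : ∀ (a : Fin M') (b : Fin M), ContDiffOn ℝ (⊤ : ℕ∞) (fun u => Ωζξ u a b) U)
    (hΩζξ : ∀ i : Fin N, ∀ u ∈ U, ∀ (a : Fin M') (b : Fin M),
      pd i (fun v => Ωζξ v a b) u = ζ i u a * (ξ i u ᵥ* L) b) :
    (∀ i : Fin N, ∀ u ∈ U, ∀ (a : Fin M) (b : Fin M'),
      pd i (fun v => (Lᵀ * Ωξζ v - (Ωζξ v)ᵀ * K) a b) u = 0) ∧
    (∀ u ∈ U, ∀ v ∈ U,
      Lᵀ * Ωξζ u - (Ωζξ u)ᵀ * K = Lᵀ * Ωξζ v - (Ωζξ v)ᵀ * K) := by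
  have hdξζ : ∀ u ∈ U, ∀ a b, DifferentiableAt ℝ (fun v => Ωξζ v a b) u := fun u hu a b =>
    ((hΩξζsmooth a b).contDiffAt (hUopen.mem_nhds hu)).differentiableAt (by simp)
  have hdζξ : ∀ u ∈ U, ∀ a b, DifferentiableAt ℝ (fun v => Ωζξ v a b) u := fun u hu a b =>
    ((hΩζξsmooth a b).contDiffAt (hUopen.mem_nhds hu)).differentiableAt (by simp)
  have hderiv : ∀ u ∈ U, ∀ a b, HasFDerivAt (fun v => (Lᵀ * Ωξζ v - (Ωζξ v)ᵀ * K) a b)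
      (∑ c, L c a • fderiv ℝ (fun v => Ωξζ v c b) u -
        ∑ d, K d b • fderiv ℝ (fun v => Ωζξ v d a) u) u := by
    intro u hu a b
    simp only [Matrix.sub_apply, Matrix.mul_apply, Matrix.transpose_apply]
    exact (HasFDerivAt.fun_sum fun c _ => (hdξζ u hu c b).hasFDerivAt.const_mul (L c a)).sub
      (HasFDerivAt.fun_sum fun d _ => (hdζξ u hu d a).hasFDerivAt.mul_const (K d b))
  have hpd : ∀ i : Fin N, ∀ u ∈ U, ∀ (a : Fin M) (b : Fin M'),
      pd i (fun v => (Lᵀ * Ωξζ v - (Ωζξ v)ᵀ * K) a b) u = 0 := by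
    intro i u hu a b
    have hξζ : ∀ c, fderiv ℝ (fun v => Ωξζ v c b) u (Pi.single i 1) = _ :=
      fun c => hΩξζ i u hu c b
    have hζξ : ∀ d, fderiv ℝ (fun v => Ωζξ v d a) u (Pi.single i 1) = _ :=
      fun d => hΩζξ i u hu d a
    rw [pd, (hderiv u hu a b).fderiv]
    simp only [_root_.sub_apply, _root_.sum_apply, _root_.smul_apply, smul_eq_mul, hξζ, hζξ]
    simp only [Matrix.vecMul, dotProduct, ← mul_assoc, ← Finset.sum_mul]
    simp only [Finset.mul_sum, Finset.sum_mul]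
    rw [sub_eq_zero, Finset.sum_comm]
    exact Finset.sum_congr rfl fun d _ => Finset.sum_congr rfl fun c _ => by ring
  refine ⟨hpd, fun u hu v hv => ?_⟩
  ext a b
  exact hUopen.is_const_of_fderiv_eq_zero (𝕜 := ℝ) hUconn.isPreconnected
    (fun w hw => (hderiv w hw a b).differentiableAt.differentiableWithinAt)
    (fun w hw => fderiv_eq_zero_of_pd_eq_zero fun i => hpd i w hw a b) hu hv
end

section
/- Let β_ij : U → ℝ (i ≠ j) be smooth functions on U ⊆ ℝ^N (open, connected, nonempty) with β_ij = β_ji. Let ξ_i : U → ℝ^M and ζ_i : U → ℝ^{M'} be X-solutions for β, L an M×M matrix, K an M'×M' matrix, and set ξ*_i := ξ_iᵀ L, ζ*_i := ζ_iᵀ K. Let Ω(ξ,ξ*), Ω(ξ,ζ*), Ω(ζ,ξ*) be potentials satisfying the constraints Lᵀ Ω(ξ,ζ*) − Ω(ζ,ξ*)ᵀ K = 0 and Lᵀ Ω(ξ,ξ*) − Ω(ξ,ξ*)ᵀ L = 0 on U. Then at every point where Ω(ξ,ξ*) is invertible, the transformed families ζ̂_i := ζ_i − Ω(ζ,ξ*)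 Ω(ξ,ξ*)⁻¹ ξ_i and ζ̂*_i := ζ*_i − ξ*_i Ω(ξ,ξ*)⁻¹ Ω(ξ,ζ*) satisfy ζ̂*_i = ζ̂_iᵀ K for all i = 1,…,N. -/
open Matrix Finset

/-- If `Lᵀ * A = Aᵀ * L` and `Lᵀ * B = Cᵀ * K` with `A` invertible, then
`L * (A⁻¹ * B) = (C * A⁻¹)ᵀ * K`. -/
theorem mul_inv_mul_eq_transpose_mul {m n R : Type*} [Fintype m] [DecidableEq m] [Fintype n]
    [CommRing R] {L A : Matrix m m R} {B : Matrix m n R} {C : Matrix n m R} {K : Matrix n n R}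
    (hA : IsUnit A.det) (hLA : Lᵀ * A = Aᵀ * L) (hLB : Lᵀ * B = Cᵀ * K) :
    L * (A⁻¹ * B) = (C * A⁻¹)ᵀ * K := by
  have hAT : IsUnit (Aᵀ).det := by rwa [det_transpose]
  have hL : L * A⁻¹ = (Aᵀ)⁻¹ * Lᵀ := by
    calc L * A⁻¹ = (Aᵀ)⁻¹ * (Aᵀ * L) * A⁻¹ := by rw [nonsing_inv_mul_cancel_left _ _ hAT]
      _ = (Aᵀ)⁻¹ * Lᵀ := by
        rw [← hLA, Matrix.mul_assoc, mul_nonsing_inv_cancel_right _ _ hA]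
  rw [← Matrix.mul_assoc, hL, Matrix.mul_assoc, hLB, transpose_mul, transpose_nonsing_inv,
    Matrix.mul_assoc]

/-- Under the constraints `Lᵀ Ω(ξ,ζ*) = Ω(ζ,ξ*)ᵀ K` and
`Lᵀ Ω(ξ,ξ*) = Ω(ξ,ξ*)ᵀ L`, the transformed families satisfy `ζ̂*_i = ζ̂_iᵀ K` wherever
`Ω(ξ,ξ*)` is invertible. -/
theorem stmt_3 {N M M' : ℕ} (hN : 2 ≤ N)
    (U : Set (Fin N → ℝ)) (hUopen : IsOpen U) (hUconn : IsConnected U)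
    (β : Fin N → Fin N → (Fin N → ℝ) → ℝ)
    (hβsmooth : ∀ i j : Fin N, i ≠ j → ContDiffOn ℝ (⊤ : ℕ∞) (β i j) U)
    (hβsym : ∀ i j : Fin N, i ≠ j → ∀ u ∈ U, β i j u = β j i u)
    (ξ : Fin N → (Fin N → ℝ) → Fin M → ℝ)
    (hξsmooth : ∀ (j : Fin N) (a : Fin M), ContDiffOn ℝ (⊤ : ℕ∞) (fun u => ξ j u a) U)
    (hξX : ∀ i j : Fin N, i ≠ j → ∀ u ∈ U, ∀ a : Fin M,
      pd i (fun v => ξ j v a) u = β j i u * ξ i u a)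
    (ζ : Fin N → (Fin N → ℝ) → Fin M' → ℝ)
    (hζsmooth : ∀ (j : Fin N) (a : Fin M'), ContDiffOn ℝ (⊤ : ℕ∞) (fun u => ζ j u a) U)
    (hζX : ∀ i j : Fin N, i ≠ j → ∀ u ∈ U, ∀ a : Fin M',
      pd i (fun v => ζ j v a) u = β j i u * ζ i u a)
    (L : Matrix (Fin M) (Fin M) ℝ) (K : Matrix (Fin M') (Fin M') ℝ)
    (Ωξξ : (Fin N → ℝ) → Matrix (Fin M) (Fin M) ℝ)
    (hΩξξsmooth : ∀ (a b : Fin M), ContDiffOn ℝ (⊤ : ℕ∞) (fun u => Ωξξ u a b) U)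
    (hΩξξ : ∀ i : Fin N, ∀ u ∈ U, ∀ (a b : Fin M),
      pd i (fun v => Ωξξ v a b) u = ξ i u a * (ξ i u ᵥ* L) b)
    (Ωξζ : (Fin N → ℝ) → Matrix (Fin M) (Fin M') ℝ)
    (hΩξζsmooth : ∀ (a : Fin M) (b : Fin M'), ContDiffOn ℝ (⊤ : ℕ∞) (fun u => Ωξζ u a b) U)
    (hΩξζ : ∀ i : Fin N, ∀ u ∈ U, ∀ (a : Fin M) (b : Fin M'),
      pd i (fun v => Ωξζ v a b) u = ξ i u a * (ζ i u ᵥ* K) b)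
    (Ωζξ : (Fin N → ℝ) → Matrix (Fin M') (Fin M) ℝ)
    (hΩζξsmooth : ∀ (a : Fin M') (b : Fin M), ContDiffOn ℝ (⊤ : ℕ∞) (fun u => Ωζξ u a b) U)
    (hΩζξ : ∀ i : Fin N, ∀ u ∈ U, ∀ (a : Fin M') (b : Fin M),
      pd i (fun v => Ωζξ v a b) u = ζ i u a * (ξ i u ᵥ* L) b)
    (hconstraint1 : ∀ u ∈ U, Lᵀ * Ωξζ u - (Ωζξ u)ᵀ * K = 0)
    (hconstraint2 : ∀ u ∈ U, Lᵀ * Ωξξ u - (Ωξξ u)ᵀ * L = 0) :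
    ∀ u ∈ U, IsUnit (Ωξξ u).det → ∀ i : Fin N,
      ζ i u ᵥ* K - (ξ i u ᵥ* L) ᵥ* ((Ωξξ u)⁻¹ * Ωξζ u)
        = (ζ i u - (Ωζξ u * (Ωξξ u)⁻¹) *ᵥ ξ i u) ᵥ* K := by
  intro u hu hdet i
  rw [sub_vecMul, vecMul_vecMul, mul_inv_mul_eq_transpose_mul hdet
    (sub_eq_zero.mp (hconstraint2 u hu)) (sub_eq_zero.mp (hconstraint1 u hu)),
    ← vecMul_vecMul, vecMul_transpose]
end

section
/- Let β_ij : U → ℝ (i ≠ j) satisfy the Darboux equations ∂_k β_ij = β_ik β_kj for all pairwise distinct i,j,k, on a nonempty open connected U ⊆ ℝ^N. Let ξ_i : U → ℝ^M be an X-solution and ξ*_i an H-solution (row vectors of length M) for β, and let Ω := Ω(ξ,ξ*) be a potential, assumed invertible at every point of U. Then the transformed functions β̂_ij := β_ij − ξ*_j Ω⁻¹ ξ_i (i ≠ j) also satisfy the Darboux equations ∂_k β̂_ij = β̂_ik β̂_kj for all pairwise distinct i,j,k. -/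
open Matrix Finset

section PartialDerivative

variable {N M : ℕ}

theorem pd_dotProduct {f g : (Fin N → ℝ) → Fin M → ℝ} {u : Fin N → ℝ} (k : Fin N)
    (hf : ∀ a, DifferentiableAt ℝ (fun v => f v a) u)
    (hg : ∀ a, DifferentiableAt ℝ (fun v => g v a) u) :
    pd k (fun v => f v ⬝ᵥ g v) u
      = (fun a => pd k (fun v => f v a) u) ⬝ᵥ g u
        + f u ⬝ᵥ fun a => pd k (fun v => g v a) u := by
  have h : HasFDerivAt (fun v => ∑ a, f v a * g v a) _ u :=
    HasFDerivAt.fun_sum fun a _ => (hf a).hasFDerivAt.mul (hg a).hasFDerivAt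
  simp only [pd, dotProduct, h.fderiv, ← Finset.sum_add_distrib, _root_.sum_apply,
    _root_.add_apply, _root_.smul_apply, smul_eq_mul]
  exact Finset.sum_congr rfl fun a _ => by ring

theorem differentiableAt_dotProduct {f g : (Fin N → ℝ) → Fin M → ℝ} {u : Fin N → ℝ}
    (hf : ∀ a, DifferentiableAt ℝ (fun v => f v a) u)
    (hg : ∀ a, DifferentiableAt ℝ (fun v => g v a) u) :
    DifferentiableAt ℝ (fun v => f v ⬝ᵥ g v) u :=
  DifferentiableAt.fun_sum fun a _ => (hf a).mul (hg a)

theorem differentiableAt_det {A : (Fin N → ℝ) → Matrix (Fin M) (Fin M) ℝ} {u : Fin N → ℝ}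
    (hA : ∀ a b, DifferentiableAt ℝ (fun v => A v a b) u) :
    DifferentiableAt ℝ (fun v => (A v).det) u := by
  simp only [Matrix.det_apply']
  exact DifferentiableAt.fun_sum fun σ _ =>
    (HasFDerivAt.finsetProd fun a _ => (hA (σ a) a).hasFDerivAt).differentiableAt.const_mul _

theorem differentiableAt_matrix_inv_apply {A : (Fin N → ℝ) → Matrix (Fin M) (Fin M) ℝ}
    {u : Fin N → ℝ} (hA : ∀ a b, DifferentiableAt ℝ (fun v => A v a b) u)
    (hu : IsUnit (A u).det) (a b : Fin M) :
    DifferentiableAt ℝ (fun v => (A v)⁻¹ a b) u := by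
  simp only [Matrix.inv_def, Ring.inverse_eq_inv', Matrix.smul_apply, smul_eq_mul,
    Matrix.adjugate_apply]
  refine ((differentiableAt_det hA).inv hu.ne_zero).mul (differentiableAt_det fun c d => ?_)
  by_cases hc : c = b
  · simp [hc]
  · simpa [Matrix.updateRow_ne hc] using hA c d

/-- The derivative of `x A⁻¹` when `∂_k A = p q` has rank one and `∂_k x = c q`. -/
theorem pd_vecMul_inv {A : (Fin N → ℝ) → Matrix (Fin M) (Fin M) ℝ}
    {x : (Fin N → ℝ) → Fin M → ℝ} {u : Fin N → ℝ} (k : Fin N) {p q : Fin M → ℝ} {c : ℝ}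
    (hA : ∀ a b, DifferentiableAt ℝ (fun v => A v a b) u)
    (hx : ∀ a, DifferentiableAt ℝ (fun v => x v a) u)
    (hu : ∀ᶠ v in nhds u, IsUnit (A v).det)
    (hpA : ∀ a b, pd k (fun v => A v a b) u = p a * q b)
    (hpx : ∀ b, pd k (fun v => x v b) u = c * q b) :
    (fun b => pd k (fun v => (x v ᵥ* (A v)⁻¹) b) u)
      = (c - (x u ᵥ* (A u)⁻¹) ⬝ᵥ p) • (q ᵥ* (A u)⁻¹) := by
  have hdy : ∀ b, DifferentiableAt ℝ (fun v => (x v ᵥ* (A v)⁻¹) b) u := fun b =>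
    differentiableAt_dotProduct hx fun a =>
      differentiableAt_matrix_inv_apply hA hu.self_of_nhds a b
  have key : (fun b => pd k (fun v => (x v ᵥ* (A v)⁻¹) b) u) ᵥ* A u
      = (c - (x u ᵥ* (A u)⁻¹) ⬝ᵥ p) • q := by
    ext b
    have hxy : (fun v => (x v ᵥ* (A v)⁻¹) ⬝ᵥ fun a => A v a b) =ᶠ[nhds u] fun v => x v b := by
      filter_upwards [hu] with v hv
      change ((x v ᵥ* (A v)⁻¹) ᵥ* A v) b = x v b
      rw [Matrix.vecMul_vecMul, Matrix.nonsing_inv_mul _ hv, Matrix.vecMul_one]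
    have h := pd_dotProduct k hdy fun a => hA a b
    have hc : pd k (fun v => (x v ᵥ* (A v)⁻¹) ⬝ᵥ fun a => A v a b) u = c * q b := by
      rw [← hpx, pd, pd, hxy.fderiv_eq]
    have hq : ((x u ᵥ* (A u)⁻¹) ⬝ᵥ fun a => p a * q b)
        = ((x u ᵥ* (A u)⁻¹) ⬝ᵥ p) * q b := by
      simp only [dotProduct, Finset.sum_mul, mul_assoc]
    simp only [hpA] at h
    rw [hc, hq] at h
    change _ ⬝ᵥ (fun a => A u a b) = (_ - _) * q b
    linarith
  rw [← Matrix.smul_vecMul, ← key, Matrix.vecMul_vecMul,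
    Matrix.mul_nonsing_inv _ hu.self_of_nhds, Matrix.vecMul_one]

end PartialDerivative

/-- The vectorial fundamental transformation
`β̂_ij = β_ij − ξ*_j Ω⁻¹ ξ_i` preserves the Darboux equations. -/
theorem stmt_4 {N M : ℕ} (hN : 2 ≤ N)
    (U : Set (Fin N → ℝ)) (hUopen : IsOpen U) (hUconn : IsConnected U)
    (β : Fin N → Fin N → (Fin N → ℝ) → ℝ)
    (hβsmooth : ∀ i j : Fin N, i ≠ j → ContDiffOn ℝ (⊤ : ℕ∞) (β i j) U)
    (hDarboux : ∀ i j k : Fin N, i ≠ j → j ≠ k → i ≠ k → ∀ u ∈ U,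
      pd k (β i j) u = β i k u * β k j u)
    (ξ : Fin N → (Fin N → ℝ) → Fin M → ℝ)
    (hξsmooth : ∀ (j : Fin N) (a : Fin M), ContDiffOn ℝ (⊤ : ℕ∞) (fun u => ξ j u a) U)
    (hξX : ∀ i j : Fin N, i ≠ j → ∀ u ∈ U, ∀ a : Fin M,
      pd i (fun v => ξ j v a) u = β j i u * ξ i u a)
    (ξs : Fin N → (Fin N → ℝ) → Fin M → ℝ)
    (hξssmooth : ∀ (j : Fin N) (b : Fin M), ContDiffOn ℝ (⊤ : ℕ∞) (fun u => ξs j u b) U)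
    (hξsH : ∀ i j : Fin N, i ≠ j → ∀ u ∈ U, ∀ b : Fin M,
      pd i (fun v => ξs j v b) u = β i j u * ξs i u b)
    (Ω : (Fin N → ℝ) → Matrix (Fin M) (Fin M) ℝ)
    (hΩsmooth : ∀ (a b : Fin M), ContDiffOn ℝ (⊤ : ℕ∞) (fun u => Ω u a b) U)
    (hΩ : ∀ i : Fin N, ∀ u ∈ U, ∀ (a b : Fin M),
      pd i (fun v => Ω v a b) u = ξ i u a * ξs i u b)
    (hΩinv : ∀ u ∈ U, IsUnit (Ω u).det) :
    ∀ i j k : Fin N, i ≠ j → j ≠ k → i ≠ k → ∀ u ∈ U,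
      pd k (fun v => β i j v - (ξs j v ᵥ* (Ω v)⁻¹) ⬝ᵥ ξ i v) u
        = (β i k u - (ξs k u ᵥ* (Ω u)⁻¹) ⬝ᵥ ξ i u)
          * (β k j u - (ξs j u ᵥ* (Ω u)⁻¹) ⬝ᵥ ξ k u) := by
  intro i j k hij hjk hik u hu
  have hU : U ∈ nhds u := hUopen.mem_nhds hu
  have hdiff : ∀ {f : (Fin N → ℝ) → ℝ}, ContDiffOn ℝ (⊤ : ℕ∞) f U → DifferentiableAt ℝ f u :=
    fun hf => (hf.contDiffAt hU).differentiableAt (by simp)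
  have hdΩ := fun a b => hdiff (hΩsmooth a b)
  have hdξ := fun a => hdiff (hξsmooth i a)
  have hdξs := fun a => hdiff (hξssmooth j a)
  have hdy : ∀ b, DifferentiableAt ℝ (fun v => (ξs j v ᵥ* (Ω v)⁻¹) b) u := fun b =>
    differentiableAt_dotProduct hdξs fun a =>
      differentiableAt_matrix_inv_apply hdΩ (hΩinv u hu) a b
  have hy := pd_vecMul_inv k hdΩ hdξs (Filter.eventually_of_mem hU hΩinv) (hΩ k u hu)
    (hξsH k j hjk.symm u hu)
  have hξi : (fun a => pd k (fun v => ξ i v a) u) = β i k u • ξ k u :=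
    funext (hξX k i hik.symm u hu)
  have hsub : pd k (fun v => β i j v - (ξs j v ᵥ* (Ω v)⁻¹) ⬝ᵥ ξ i v) u
      = pd k (β i j) u - pd k (fun v => (ξs j v ᵥ* (Ω v)⁻¹) ⬝ᵥ ξ i v) u := by
    simp only [pd]
    rw [fderiv_fun_sub (hdiff (hβsmooth i j hij)) (differentiableAt_dotProduct hdy hdξ)]
    rfl
  rw [hsub, hDarboux i j k hij hjk hik u hu, pd_dotProduct k hdy hdξ, hy, hξi,
    smul_dotProduct, dotProduct_smul, smul_eq_mul, smul_eq_mul]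
  ring
end

section
/- Let β_ij satisfy the Darboux equations on a nonempty open connected U ⊆ ℝ^N, let ξ_i : U → ℝ^M be an X-solution and ξ*_i an H-solution for β, with potential Ω := Ω(ξ,ξ*) invertible everywhere on U, and set β̂_ij := β_ij − ξ*_j Ω⁻¹ ξ_i. Let ζ_i : U → ℝ^{M'} be any further X-solution for β and Ω(ζ,ξ*) a potential for (ζ,ξ*). Then the transformed family ζ̂_i := ζ_i − Ω(ζ,ξ*) Ω⁻¹ ξ_i is an X-solution for β̂, i.e. ∂_i ζ̂_j = β̂_ji ζ̂_i for all i ≠ j. -/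
open Matrix Finset

theorem differentiableAt_matrix_det {E : Type*} [NormedAddCommGroup E] [NormedSpace ℝ E] {n : ℕ}
    {A : E → Matrix (Fin n) (Fin n) ℝ} {u : E}
    (hA : ∀ a b, DifferentiableAt ℝ (fun v => A v a b) u) :
    DifferentiableAt ℝ (fun v => (A v).det) u := by
  simp only [Matrix.det_apply']
  refine DifferentiableAt.fun_sum fun σ _ => (differentiableAt_const _).mul ?_
  exact (HasFDerivAt.finsetProd fun a _ => (hA (σ a) a).hasFDerivAt).differentiableAt

theorem differentiableAt_matrix_inv {E : Type*} [NormedAddCommGroup E] [NormedSpace ℝ E] {n : ℕ}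
    {A : E → Matrix (Fin n) (Fin n) ℝ} {u : E}
    (hA : ∀ a b, DifferentiableAt ℝ (fun v => A v a b) u) (hdet : IsUnit (A u).det)
    (a b : Fin n) : DifferentiableAt ℝ (fun v => (A v)⁻¹ a b) u := by
  simp only [Matrix.inv_def, Ring.inverse_eq_inv', Matrix.smul_apply, smul_eq_mul,
    Matrix.adjugate_apply]
  refine ((differentiableAt_matrix_det hA).inv hdet.ne_zero).mul
    (differentiableAt_matrix_det fun c d => ?_)
  by_cases h : c = b
  · subst h
    simp
  · simpa [Matrix.updateRow_ne h] using hA c d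

/-- Leibniz rule for the partial derivative of a matrix-vector product, in one component. -/
theorem pd_mulVec {N m n : ℕ} (i : Fin N) {A : (Fin N → ℝ) → Matrix (Fin m) (Fin n) ℝ}
    {x : (Fin N → ℝ) → Fin n → ℝ} {u : Fin N → ℝ} (a : Fin m)
    (hA : ∀ b, DifferentiableAt ℝ (fun v => A v a b) u)
    (hx : ∀ b, DifferentiableAt ℝ (fun v => x v b) u) :
    pd i (fun v => (A v *ᵥ x v) a) u
      = (fun b => pd i (fun v => A v a b) u) ⬝ᵥ x u
        + A u a ⬝ᵥ fun b => pd i (fun v => x v b) u := by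
  simp only [pd, Matrix.mulVec, dotProduct]
  rw [fderiv_fun_sum fun b _ => (hA b).fun_mul (hx b), ← Finset.sum_add_distrib,
    _root_.sum_apply]
  refine Finset.sum_congr rfl fun b _ => ?_
  rw [fderiv_fun_mul (hA b) (hx b)]
  simp
  ring

/-- The transformed family `ζ̂_i := ζ_i − Ω(ζ,ξ*) Ω⁻¹ ξ_i` is an X-solution for
the transformed rotation coefficients `β̂_ij := β_ij − ξ*_j Ω⁻¹ ξ_i`. -/
theorem stmt_5 {N M M' : ℕ} (hN : 2 ≤ N)
    (U : Set (Fin N → ℝ)) (hUopen : IsOpen U) (hUconn : IsConnected U)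
    (β : Fin N → Fin N → (Fin N → ℝ) → ℝ)
    (hβsmooth : ∀ i j : Fin N, i ≠ j → ContDiffOn ℝ (⊤ : ℕ∞) (β i j) U)
    (hDarboux : ∀ i j k : Fin N, i ≠ j → j ≠ k → i ≠ k → ∀ u ∈ U,
      pd k (β i j) u = β i k u * β k j u)
    (ξ : Fin N → (Fin N → ℝ) → Fin M → ℝ)
    (hξsmooth : ∀ (j : Fin N) (a : Fin M), ContDiffOn ℝ (⊤ : ℕ∞) (fun u => ξ j u a) U)
    (hξX : ∀ i j : Fin N, i ≠ j → ∀ u ∈ U, ∀ a : Fin M,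
      pd i (fun v => ξ j v a) u = β j i u * ξ i u a)
    (ξs : Fin N → (Fin N → ℝ) → Fin M → ℝ)
    (hξssmooth : ∀ (j : Fin N) (b : Fin M), ContDiffOn ℝ (⊤ : ℕ∞) (fun u => ξs j u b) U)
    (hξsH : ∀ i j : Fin N, i ≠ j → ∀ u ∈ U, ∀ b : Fin M,
      pd i (fun v => ξs j v b) u = β i j u * ξs i u b)
    (Ω : (Fin N → ℝ) → Matrix (Fin M) (Fin M) ℝ)
    (hΩsmooth : ∀ (a b : Fin M), ContDiffOn ℝ (⊤ : ℕ∞) (fun u => Ω u a b) U)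
    (hΩ : ∀ i : Fin N, ∀ u ∈ U, ∀ (a b : Fin M),
      pd i (fun v => Ω v a b) u = ξ i u a * ξs i u b)
    (hΩinv : ∀ u ∈ U, IsUnit (Ω u).det)
    (ζ : Fin N → (Fin N → ℝ) → Fin M' → ℝ)
    (hζsmooth : ∀ (j : Fin N) (a : Fin M'), ContDiffOn ℝ (⊤ : ℕ∞) (fun u => ζ j u a) U)
    (hζX : ∀ i j : Fin N, i ≠ j → ∀ u ∈ U, ∀ a : Fin M',
      pd i (fun v => ζ j v a) u = β j i u * ζ i u a)
    (Ωζξ : (Fin N → ℝ) → Matrix (Fin M') (Fin M) ℝ)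
    (hΩζξsmooth : ∀ (a : Fin M') (b : Fin M), ContDiffOn ℝ (⊤ : ℕ∞) (fun u => Ωζξ u a b) U)
    (hΩζξ : ∀ i : Fin N, ∀ u ∈ U, ∀ (a : Fin M') (b : Fin M),
      pd i (fun v => Ωζξ v a b) u = ζ i u a * ξs i u b) :
    ∀ i j : Fin N, i ≠ j → ∀ u ∈ U, ∀ a : Fin M',
      pd i (fun v => ζ j v a - ((Ωζξ v * (Ω v)⁻¹) *ᵥ ξ j v) a) u
        = (β j i u - (ξs i u ᵥ* (Ω u)⁻¹) ⬝ᵥ ξ j u)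
          * (ζ i u a - ((Ωζξ u * (Ω u)⁻¹) *ᵥ ξ i u) a) := by
  intro i j hij u hu a
  have hdiff {f : (Fin N → ℝ) → ℝ} (hf : ContDiffOn ℝ (⊤ : ℕ∞) f U) : DifferentiableAt ℝ f u :=
    (hf.contDiffAt (hUopen.mem_nhds hu)).differentiableAt (by simp)
  have hΩd b c : DifferentiableAt ℝ (fun v => Ω v b c) u := hdiff (hΩsmooth b c)
  let x : (Fin N → ℝ) → Fin M → ℝ := fun v => (Ω v)⁻¹ *ᵥ ξ j v
  have hxd b : DifferentiableAt ℝ (fun v => x v b) u := by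
    simp only [x, Matrix.mulVec, dotProduct]
    exact DifferentiableAt.fun_sum fun c _ =>
      (differentiableAt_matrix_inv hΩd (hΩinv u hu) b c).mul (hdiff (hξsmooth j c))
  let dx : Fin M → ℝ := fun b => pd i (fun v => x v b) u
  -- Differentiating `Ω x = ξ_j` determines the derivative of `x = Ω⁻¹ ξ_j`.
  have hΩdx : Ω u *ᵥ dx = (β j i u - ξs i u ⬝ᵥ x u) • ξ i u := by
    funext b
    have hloc : (fun v => (Ω v *ᵥ x v) b) =ᶠ[nhds u] fun v => ξ j v b := by
      filter_upwards [hUopen.mem_nhds hu] with v hv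
      simp [x, Matrix.mulVec_mulVec, Matrix.mul_nonsing_inv _ (hΩinv v hv)]
    have hprod := pd_mulVec i b (hΩd b) hxd
    have hpd : pd i (fun v => (Ω v *ᵥ x v) b) u = β j i u * ξ i u b := by
      rw [← hξX i j hij u hu b, pd, pd, hloc.fderiv_eq]
    have hrow : (fun c => pd i (fun v => Ω v b c) u) = ξ i u b • ξs i u :=
      funext fun c => hΩ i u hu b c
    rw [hpd, hrow, smul_dotProduct, smul_eq_mul] at hprod
    change Ω u b ⬝ᵥ dx = (β j i u - ξs i u ⬝ᵥ x u) * ξ i u b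
    linear_combination -hprod
  have hdx : dx = (β j i u - ξs i u ⬝ᵥ x u) • ((Ω u)⁻¹ *ᵥ ξ i u) := by
    rw [← Matrix.mulVec_smul, ← hΩdx, Matrix.mulVec_mulVec,
      Matrix.nonsing_inv_mul _ (hΩinv u hu), Matrix.one_mulVec]
  have hprod := pd_mulVec i a (fun b => hdiff (hΩζξsmooth a b)) hxd
  have hrow : (fun c => pd i (fun v => Ωζξ v a c) u) = ζ i u a • ξs i u :=
    funext fun c => hΩζξ i u hu a c
  have hΩζξx : DifferentiableAt ℝ (fun v => (Ωζξ v *ᵥ x v) a) u := by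
    simp only [Matrix.mulVec, dotProduct]
    exact DifferentiableAt.fun_sum fun c _ => (hdiff (hΩζξsmooth a c)).mul (hxd c)
  change _ = _ + Ωζξ u a ⬝ᵥ dx at hprod
  rw [hrow, hdx, smul_dotProduct, dotProduct_smul, smul_eq_mul, smul_eq_mul] at hprod
  have hζ := hζX i j hij u hu a
  simp only [← Matrix.mulVec_mulVec, ← Matrix.dotProduct_mulVec]
  change pd i (fun v => ζ j v a - (Ωζξ v *ᵥ x v) a) u
    = (β j i u - ξs i u ⬝ᵥ x u) * (ζ i u a - Ωζξ u a ⬝ᵥ ((Ω u)⁻¹ *ᵥ ξ i u))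
  have hsub : pd i (fun v => ζ j v a - (Ωζξ v *ᵥ x v) a) u
      = pd i (fun v => ζ j v a) u - pd i (fun v => (Ωζξ v *ᵥ x v) a) u := by
    simp only [pd]
    rw [fderiv_fun_sub (hdiff (hζsmooth j a)) hΩζξx, _root_.sub_apply]
  rw [hsub, hζ, hprod]
  ring
end

section
/- Let L and Ω be real M×M matrices with Ω invertible and Lᵀ Ω = Ωᵀ L. Then for all vectors a, b ∈ ℝ^M one has bᵀ L Ω⁻¹ a = aᵀ L Ω⁻¹ b. Consequently, if β_ij : U → ℝ (i ≠ j) are symmetric (β_ij = β_ji), ξ_i : U → ℝ^M is an X-solution for β, ξ*_i := ξ_iᵀ L, and Ω(ξ,ξ*) is a potential that is invertible and satisfies Lᵀ Ω(ξ,ξ*) = Ω(ξ,ξ*)ᵀ L on U, then the transformed rotation coefficients β̂_ij := β_ij − ξ*_j Ω(ξ,ξ*)⁻¹ ξ_i are again symmetric: β̂_ij = β̂_ji for all i ≠ j. -/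
open Matrix Finset

/-- If `Lᵀ Ω = Ωᵀ L` with `Ω` invertible, then `L Ω⁻¹` is symmetric. -/
theorem isSymm_mul_inv_of_transpose_mul_eq {n R : Type*} [Fintype n] [DecidableEq n] [CommRing R]
    {L Ω : Matrix n n R} (hΩ : IsUnit Ω.det) (h : Lᵀ * Ω = Ωᵀ * L) : (L * Ω⁻¹).IsSymm := by
  have hT : IsUnit Ωᵀ.det := by rwa [det_transpose]
  calc (L * Ω⁻¹)ᵀ = Ωᵀ⁻¹ * Lᵀ := by rw [transpose_mul, transpose_nonsing_inv]
    _ = Ωᵀ⁻¹ * (Lᵀ * Ω * Ω⁻¹) := by rw [mul_nonsing_inv_cancel_right _ _ hΩ]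
    _ = L * Ω⁻¹ := by rw [h, Matrix.mul_assoc, nonsing_inv_mul_cancel_left _ _ hT]

/-- The bilinear form of a symmetric matrix is symmetric. -/
theorem dotProduct_mulVec_comm_of_isSymm {n R : Type*} [Fintype n] [CommRing R]
    {A : Matrix n n R} (hA : A.IsSymm) (a b : n → R) : b ⬝ᵥ (A *ᵥ a) = a ⬝ᵥ (A *ᵥ b) := by
  rw [dotProduct_mulVec, ← mulVec_transpose, hA.eq, dotProduct_comm]

/-- If `Lᵀ Ω = Ωᵀ L` with `Ω` invertible, then `bᵀ L Ω⁻¹ a = aᵀ L Ω⁻¹ b` for all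
vectors `a, b`; consequently the symmetric fundamental transformation preserves the symmetry of
the rotation coefficients. -/
theorem stmt_8 {N M : ℕ} (hN : 2 ≤ N)
    (U : Set (Fin N → ℝ)) (hUopen : IsOpen U) (hUconn : IsConnected U)
    (β : Fin N → Fin N → (Fin N → ℝ) → ℝ)
    (hβsmooth : ∀ i j : Fin N, i ≠ j → ContDiffOn ℝ (⊤ : ℕ∞) (β i j) U)
    (hβsym : ∀ i j : Fin N, i ≠ j → ∀ u ∈ U, β i j u = β j i u)
    (ξ : Fin N → (Fin N → ℝ) → Fin M → ℝ)
    (hξsmooth : ∀ (j : Fin N) (a : Fin M), ContDiffOn ℝ (⊤ : ℕ∞) (fun u => ξ j u a) U)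
    (hξX : ∀ i j : Fin N, i ≠ j → ∀ u ∈ U, ∀ a : Fin M,
      pd i (fun v => ξ j v a) u = β j i u * ξ i u a)
    (L : Matrix (Fin M) (Fin M) ℝ)
    (Ω : (Fin N → ℝ) → Matrix (Fin M) (Fin M) ℝ)
    (hΩsmooth : ∀ (a b : Fin M), ContDiffOn ℝ (⊤ : ℕ∞) (fun u => Ω u a b) U)
    (hΩpot : ∀ i : Fin N, ∀ u ∈ U, ∀ (a b : Fin M),
      pd i (fun v => Ω v a b) u = ξ i u a * (ξ i u ᵥ* L) b)
    (hΩinv : ∀ u ∈ U, IsUnit (Ω u).det)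
    (hΩsym : ∀ u ∈ U, Lᵀ * Ω u = (Ω u)ᵀ * L) :
    (∀ (L₀ Ω₀ : Matrix (Fin M) (Fin M) ℝ), IsUnit Ω₀.det → L₀ᵀ * Ω₀ = Ω₀ᵀ * L₀ →
      ∀ a b : Fin M → ℝ, b ⬝ᵥ ((L₀ * Ω₀⁻¹) *ᵥ a) = a ⬝ᵥ ((L₀ * Ω₀⁻¹) *ᵥ b)) ∧
    (∀ i j : Fin N, i ≠ j → ∀ u ∈ U,
      β i j u - ((ξ j u ᵥ* L) ᵥ* (Ω u)⁻¹) ⬝ᵥ ξ i u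
        = β j i u - ((ξ i u ᵥ* L) ᵥ* (Ω u)⁻¹) ⬝ᵥ ξ j u) := by
  refine ⟨fun L₀ Ω₀ hdet hsym =>
    dotProduct_mulVec_comm_of_isSymm (isSymm_mul_inv_of_transpose_mul_eq hdet hsym), ?_⟩
  intro i j hij u hu
  have hsymm := isSymm_mul_inv_of_transpose_mul_eq (hΩinv u hu) (hΩsym u hu)
  rw [hβsym i j hij u hu, vecMul_vecMul, vecMul_vecMul, ← dotProduct_mulVec, ← dotProduct_mulVec,
    dotProduct_mulVec_comm_of_isSymm hsymm]
end

section
/- Let L₁ be a real M₁×M₁ matrix, L₂ a real M₂×M₂ matrix, and let Ω₁₁ (M₁×M₁), Ω₁₂ (M₁×M₂), Ω₂₁ (M₂×M₁), Ω₂₂ (M₂×M₂) be real matrices satisfying L₁ᵀ Ω₁₁ = Ω₁₁ᵀ L₁, L₂ᵀ Ω₂₂ = Ω₂₂ᵀ L₂, and L₁ᵀ Ω₁₂ = Ω₂₁ᵀ L₂, with Ω₂₂ invertible. Then the Schur complement Ω' := Ω₁₁ − Ω₁₂ Ω₂₂⁻¹ Ω₂₁ satisfies L₁ᵀ Ω'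 = Ω'ᵀ L₁. (Hence the symmetry constraint of the vectorial symmetric fundamental transformation is preserved under composition of two such transformations.) -/
open Matrix

/-- The symmetry constraint of the vectorial symmetric fundamental transformation
is inherited by the Schur complement: if `L₁ᵀ Ω₁₁ = Ω₁₁ᵀ L₁`, `L₂ᵀ Ω₂₂ = Ω₂₂ᵀ L₂` and
`L₁ᵀ Ω₁₂ = Ω₂₁ᵀ L₂` with `Ω₂₂` invertible, then
`L₁ᵀ (Ω₁₁ − Ω₁₂ Ω₂₂⁻¹ Ω₂₁) = (Ω₁₁ − Ω₁₂ Ω₂₂⁻¹ Ω₂₁)ᵀ L₁`. -/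
theorem stmt_11 {M₁ M₂ : ℕ}
    (L₁ : Matrix (Fin M₁) (Fin M₁) ℝ) (L₂ : Matrix (Fin M₂) (Fin M₂) ℝ)
    (Ω₁₁ : Matrix (Fin M₁) (Fin M₁) ℝ) (Ω₁₂ : Matrix (Fin M₁) (Fin M₂) ℝ)
    (Ω₂₁ : Matrix (Fin M₂) (Fin M₁) ℝ) (Ω₂₂ : Matrix (Fin M₂) (Fin M₂) ℝ)
    (h₁₁ : L₁ᵀ * Ω₁₁ = Ω₁₁ᵀ * L₁)
    (h₂₂ : L₂ᵀ * Ω₂₂ = Ω₂₂ᵀ * L₂)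
    (h₁₂ : L₁ᵀ * Ω₁₂ = Ω₂₁ᵀ * L₂)
    (hΩ₂₂ : IsUnit Ω₂₂.det) :
    L₁ᵀ * (Ω₁₁ - Ω₁₂ * Ω₂₂⁻¹ * Ω₂₁) = (Ω₁₁ - Ω₁₂ * Ω₂₂⁻¹ * Ω₂₁)ᵀ * L₁ := by
  have h₂₁ : Ω₁₂ᵀ * L₁ = L₂ᵀ * Ω₂₁ := by
    simpa using congrArg transpose h₁₂
  have hT : IsUnit Ω₂₂ᵀ.det := by rwa [det_transpose]
  have hinv : L₂ * Ω₂₂⁻¹ = (Ω₂₂⁻¹)ᵀ * L₂ᵀ := by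
    rw [transpose_nonsing_inv]
    calc L₂ * Ω₂₂⁻¹ = Ω₂₂ᵀ⁻¹ * (Ω₂₂ᵀ * L₂) * Ω₂₂⁻¹ := by
          rw [nonsing_inv_mul_cancel_left _ _ hT]
      _ = Ω₂₂ᵀ⁻¹ * L₂ᵀ := by
          rw [← h₂₂, ← Matrix.mul_assoc, mul_nonsing_inv_cancel_right _ _ hΩ₂₂]
  have hcorr : L₁ᵀ * (Ω₁₂ * Ω₂₂⁻¹ * Ω₂₁) = (Ω₁₂ * Ω₂₂⁻¹ * Ω₂₁)ᵀ * L₁ :=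
    calc L₁ᵀ * (Ω₁₂ * Ω₂₂⁻¹ * Ω₂₁) = L₁ᵀ * Ω₁₂ * Ω₂₂⁻¹ * Ω₂₁ := by
          simp only [Matrix.mul_assoc]
      _ = Ω₂₁ᵀ * (L₂ * Ω₂₂⁻¹) * Ω₂₁ := by rw [h₁₂, Matrix.mul_assoc Ω₂₁ᵀ]
      _ = Ω₂₁ᵀ * (Ω₂₂⁻¹)ᵀ * (Ω₁₂ᵀ * L₁) := by
          rw [hinv, h₂₁]; simp only [Matrix.mul_assoc]
      _ = (Ω₁₂ * Ω₂₂⁻¹ * Ω₂₁)ᵀ * L₁ := by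
          simp only [transpose_mul, Matrix.mul_assoc]
  rw [Matrix.mul_sub, transpose_sub, Matrix.sub_mul, h₁₁, hcorr]
end

section
/- Let β_ij : U → ℝ (i ≠ j) satisfy the Lamé equations on a nonempty open connected U ⊆ ℝ^N: (i) ∂_k β_ij = β_ik β_kj for pairwise distinct i,j,k, and (ii) ∂_i β_ij + ∂_j β_ji + Σ_{k≠i,j} β_ki β_kj = 0 for all i ≠ j. Let ξ_i : U → ℝ^M be an X-solution for β. Then the row-vector-valued functions ξ*_i := (∂_i ξ_i + Σ_{k≠i} ξ_k β_ki)ᵀ form an H-solution for β, i.e. ∂_i ξ*_j = β_ij ξ*_i for all i ≠ j. -/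
open Matrix Finset

/-- The row-vector family `ξ*_i := (∂_i ξ_i + Σ_{k≠i} ξ_k β_ki)ᵀ` associated to an X-solution
`ξ` of the orthogonal (Lamé) reduction. -/
noncomputable def starSol {N M : ℕ} (β : Fin N → Fin N → (Fin N → ℝ) → ℝ)
    (ξ : Fin N → (Fin N → ℝ) → Fin M → ℝ) (i : Fin N) (u : Fin N → ℝ) : Fin M → ℝ :=
  fun b => pd i (fun v => ξ i v b) u + ∑ k ∈ Finset.univ.erase i, ξ k u b * β k i u

theorem pd_add {N : ℕ} (i : Fin N) {f g : (Fin N → ℝ) → ℝ} {u : Fin N → ℝ}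
    (hf : DifferentiableAt ℝ f u) (hg : DifferentiableAt ℝ g u) :
    pd i (fun v => f v + g v) u = pd i f u + pd i g u := by
  simp [pd, fderiv_fun_add hf hg]

theorem pd_mul {N : ℕ} (i : Fin N) {f g : (Fin N → ℝ) → ℝ} {u : Fin N → ℝ}
    (hf : DifferentiableAt ℝ f u) (hg : DifferentiableAt ℝ g u) :
    pd i (fun v => f v * g v) u = pd i f u * g u + f u * pd i g u := by
  simp only [pd, fderiv_fun_mul hf hg, _root_.add_apply, _root_.smul_apply, smul_eq_mul]
  ring

theorem pd_sum {N : ℕ} {ι : Type*} (i : Fin N) (s : Finset ι) {f : ι → (Fin N → ℝ) → ℝ}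
    {u : Fin N → ℝ} (hf : ∀ k ∈ s, DifferentiableAt ℝ (f k) u) :
    pd i (fun v => ∑ k ∈ s, f k v) u = ∑ k ∈ s, pd i (f k) u := by
  simp [pd, fderiv_fun_sum hf]

theorem pd_congr {N : ℕ} (i : Fin N) {f g : (Fin N → ℝ) → ℝ} {u : Fin N → ℝ}
    (h : f =ᶠ[nhds u] g) : pd i f u = pd i g u := by
  rw [pd, pd, h.fderiv_eq]

theorem differentiableAt_fderiv_of_contDiffAt_two {N : ℕ} {f : (Fin N → ℝ) → ℝ} {u : Fin N → ℝ}
    (hf : ContDiffAt ℝ 2 f u) : DifferentiableAt ℝ (fderiv ℝ f) u :=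
  (hf.fderiv_right (m := 1) (by norm_num)).differentiableAt (by norm_num)

theorem differentiableAt_pd {N : ℕ} (i : Fin N) {f : (Fin N → ℝ) → ℝ} {u : Fin N → ℝ}
    (hf : ContDiffAt ℝ 2 f u) : DifferentiableAt ℝ (pd i f) u :=
  (differentiableAt_fderiv_of_contDiffAt_two hf).clm_apply (differentiableAt_const _)

theorem pd_pd {N : ℕ} (i j : Fin N) {f : (Fin N → ℝ) → ℝ} {u : Fin N → ℝ}
    (hf : ContDiffAt ℝ 2 f u) :
    pd i (pd j f) u = fderiv ℝ (fderiv ℝ f) u (Pi.single i 1) (Pi.single j 1) := by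
  change fderiv ℝ (fun v => fderiv ℝ f v (Pi.single j 1)) u (Pi.single i 1) = _
  rw [fderiv_clm_apply (differentiableAt_fderiv_of_contDiffAt_two hf) (differentiableAt_const _)]
  simp

/-- Partial derivatives of a `C^2` function commute. -/
theorem pd_comm {N : ℕ} (i j : Fin N) {f : (Fin N → ℝ) → ℝ} {u : Fin N → ℝ}
    (hf : ContDiffAt ℝ 2 f u) : pd i (pd j f) u = pd j (pd i f) u := by
  rw [pd_pd i j hf, pd_pd j i hf]
  exact hf.isSymmSndFDerivAt (by simp) _ _

/-- If `β` satisfies the Lamé equations and `ξ` is an X-solution, then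
`ξ*_i := (∂_i ξ_i + Σ_{k≠i} ξ_k β_ki)ᵀ` is an H-solution for `β`. -/
theorem stmt_12 {N M : ℕ} (hN : 2 ≤ N)
    (U : Set (Fin N → ℝ)) (hUopen : IsOpen U) (hUconn : IsConnected U)
    (β : Fin N → Fin N → (Fin N → ℝ) → ℝ)
    (hβsmooth : ∀ i j : Fin N, i ≠ j → ContDiffOn ℝ (⊤ : ℕ∞) (β i j) U)
    (hLame1 : ∀ i j k : Fin N, i ≠ j → j ≠ k → i ≠ k → ∀ u ∈ U,
      pd k (β i j) u = β i k u * β k j u)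
    (hLame2 : ∀ i j : Fin N, i ≠ j → ∀ u ∈ U,
      pd i (β i j) u + pd j (β j i) u
        + ∑ k ∈ (Finset.univ.erase i).erase j, β k i u * β k j u = 0)
    (ξ : Fin N → (Fin N → ℝ) → Fin M → ℝ)
    (hξsmooth : ∀ (j : Fin N) (a : Fin M), ContDiffOn ℝ (⊤ : ℕ∞) (fun u => ξ j u a) U)
    (hξX : ∀ i j : Fin N, i ≠ j → ∀ u ∈ U, ∀ a : Fin M,
      pd i (fun v => ξ j v a) u = β j i u * ξ i u a) :
    ∀ i j : Fin N, i ≠ j → ∀ u ∈ U, ∀ b : Fin M,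
      pd i (fun v => starSol β ξ j v b) u = β i j u * starSol β ξ i u b := by
  intro i j hij u hu b
  have hnhds : U ∈ nhds u := hUopen.mem_nhds hu
  have hξ2 (k : Fin N) : ContDiffAt ℝ 2 (fun v => ξ k v b) u :=
    ((hξsmooth k b).contDiffAt hnhds).of_le (WithTop.coe_le_coe.2 (le_top : (2 : ℕ∞) ≤ ⊤))
  have hξd (k : Fin N) : DifferentiableAt ℝ (fun v => ξ k v b) u :=
    (hξ2 k).differentiableAt (by norm_num)
  have hβd (k l : Fin N) (hkl : k ≠ l) : DifferentiableAt ℝ (β k l) u :=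
    ((hβsmooth k l hkl).contDiffAt hnhds).differentiableAt (by simp)
  have hprod : ∀ k ∈ univ.erase j, DifferentiableAt ℝ (fun v => ξ k v b * β k j v) u :=
    fun k hk => (hξd k).mul (hβd k j (ne_of_mem_erase hk))
  have hmixed : pd i (pd j fun v => ξ j v b) u
      = pd j (β j i) u * ξ i u b + β j i u * (β i j u * ξ j u b) := by
    have heq : pd i (fun v => ξ j v b) =ᶠ[nhds u] fun v => β j i v * ξ i v b := by
      filter_upwards [hnhds] with v hv using hξX i j hij v hv b
    rw [pd_comm i j (hξ2 j), pd_congr j heq, pd_mul j (hβd j i hij.symm) (hξd i),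
      hξX j i hij.symm u hu b]
  have hstar : pd i (fun v => starSol β ξ j v b) u
      = pd i (pd j fun v => ξ j v b) u + ∑ k ∈ univ.erase j, pd i (fun v => ξ k v b * β k j v) u := by
    rw [← pd_sum i _ hprod]
    exact pd_add i (differentiableAt_pd j (hξ2 j)) (DifferentiableAt.fun_sum hprod)
  have hrest : ∑ k ∈ (univ.erase i).erase j, pd i (fun v => ξ k v b * β k j v) u
      = ξ i u b * ∑ k ∈ (univ.erase i).erase j, β k i u * β k j u
        + β i j u * ∑ k ∈ (univ.erase i).erase j, ξ k u b * β k i u := by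
    rw [mul_sum, mul_sum, ← sum_add_distrib]
    refine sum_congr rfl fun k hk => ?_
    have hkj : k ≠ j := ne_of_mem_erase hk
    have hki : k ≠ i := ne_of_mem_erase (mem_of_mem_erase hk)
    rw [pd_mul i (hξd k) (hβd k j hkj), hξX i k hki.symm u hu b, hLame1 k j i hkj hij.symm hki u hu]
    ring
  have hstar' : starSol β ξ i u b = pd i (fun v => ξ i v b) u
      + (ξ j u b * β j i u + ∑ k ∈ (univ.erase i).erase j, ξ k u b * β k i u) := by
    rw [starSol, ← add_sum_erase _ _ (mem_erase.2 ⟨hij.symm, mem_univ j⟩)]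
  rw [hstar, hstar', hmixed, ← add_sum_erase _ _ (mem_erase.2 ⟨hij, mem_univ i⟩),
    erase_right_comm, hrest, pd_mul i (hξd i) (hβd i j hij)]
  linear_combination ξ i u b * hLame2 i j hij u hu
end

section
/- Let β_ij : U → ℝ (i ≠ j) satisfy the Lamé equations on a nonempty open connected U ⊆ ℝ^N: ∂_k β_ij = β_ik β_kj for pairwise distinct i,j,k, and ∂_i β_ij + ∂_j β_ji + Σ_{k≠i,j} β_ki β_kj = 0 for i ≠ j. Let ξ_i : U → ℝ^M and ζ_i : U → ℝ^{M'} be X-solutions for β, and define ξ*_i := (∂_i ξ_i + Σ_{k≠i} ξ_k β_ki)ᵀ and ζ*_i := (∂_i ζ_i + Σ_{k≠i} ζ_k β_ki)ᵀ. Let Ω(ξ,ζ*) and Ω(ζ,ξ*) be potentials. Then for every i = 1,…,N, ∂_i ( Ω(ξ,ζ*) + Ω(ζ,ξ*)ᵀ − Σ_{k=1}^N ξ_k ζ_kᵀ ) = 0, so Ω(ξ,ζ*) + Ω(ζ,ξ*)ᵀ − Σ_k ξ_k ζ_kᵀ is constant on U. -/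
open Matrix Finset

theorem pd_potential_sub_sum {N : ℕ} {ι : Type*} [Fintype ι] (i : Fin N)
    {f g : (Fin N → ℝ) → ℝ} {p q : ι → (Fin N → ℝ) → ℝ} {u : Fin N → ℝ}
    (hf : DifferentiableAt ℝ f u) (hg : DifferentiableAt ℝ g u)
    (hp : ∀ k, DifferentiableAt ℝ (p k) u) (hq : ∀ k, DifferentiableAt ℝ (q k) u) :
    pd i (fun v => f v + g v - ∑ k, p k v * q k v) u
      = pd i f u + pd i g u - ∑ k, (p k u * pd i (q k) u + q k u * pd i (p k) u) := by
  have h := (hf.hasFDerivAt.add hg.hasFDerivAt).sub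
    (HasFDerivAt.fun_sum (u := Finset.univ) fun k _ => (hp k).hasFDerivAt.mul (hq k).hasFDerivAt)
  have h' : HasFDerivAt (fun v => f v + g v - ∑ k, p k v * q k v) _ u := h
  simp [pd, h'.fderiv]

/-- For the Lamé (orthogonal) reduction, the matrix
`Ω(ξ,ζ*) + Ω(ζ,ξ*)ᵀ − Σ_k ξ_k ζ_kᵀ` has vanishing partial derivatives, hence is constant. -/
theorem stmt_14 {N M M' : ℕ} (hN : 2 ≤ N)
    (U : Set (Fin N → ℝ)) (hUopen : IsOpen U) (hUconn : IsConnected U)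
    (β : Fin N → Fin N → (Fin N → ℝ) → ℝ)
    (hβsmooth : ∀ i j : Fin N, i ≠ j → ContDiffOn ℝ (⊤ : ℕ∞) (β i j) U)
    (hLame1 : ∀ i j k : Fin N, i ≠ j → j ≠ k → i ≠ k → ∀ u ∈ U,
      pd k (β i j) u = β i k u * β k j u)
    (hLame2 : ∀ i j : Fin N, i ≠ j → ∀ u ∈ U,
      pd i (β i j) u + pd j (β j i) u
        + ∑ k ∈ (Finset.univ.erase i).erase j, β k i u * β k j u = 0)
    (ξ : Fin N → (Fin N → ℝ) → Fin M → ℝ)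
    (hξsmooth : ∀ (j : Fin N) (a : Fin M), ContDiffOn ℝ (⊤ : ℕ∞) (fun u => ξ j u a) U)
    (hξX : ∀ i j : Fin N, i ≠ j → ∀ u ∈ U, ∀ a : Fin M,
      pd i (fun v => ξ j v a) u = β j i u * ξ i u a)
    (ζ : Fin N → (Fin N → ℝ) → Fin M' → ℝ)
    (hζsmooth : ∀ (j : Fin N) (a : Fin M'), ContDiffOn ℝ (⊤ : ℕ∞) (fun u => ζ j u a) U)
    (hζX : ∀ i j : Fin N, i ≠ j → ∀ u ∈ U, ∀ a : Fin M',
      pd i (fun v => ζ j v a) u = β j i u * ζ i u a)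
    (Ωξζ : (Fin N → ℝ) → Matrix (Fin M) (Fin M') ℝ)
    (hΩξζsmooth : ∀ (a : Fin M) (b : Fin M'), ContDiffOn ℝ (⊤ : ℕ∞) (fun u => Ωξζ u a b) U)
    (hΩξζ : ∀ i : Fin N, ∀ u ∈ U, ∀ (a : Fin M) (b : Fin M'),
      pd i (fun v => Ωξζ v a b) u = ξ i u a * starSol β ζ i u b)
    (Ωζξ : (Fin N → ℝ) → Matrix (Fin M') (Fin M) ℝ)
    (hΩζξsmooth : ∀ (a : Fin M') (b : Fin M), ContDiffOn ℝ (⊤ : ℕ∞) (fun u => Ωζξ u a b) U)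
    (hΩζξ : ∀ i : Fin N, ∀ u ∈ U, ∀ (a : Fin M') (b : Fin M),
      pd i (fun v => Ωζξ v a b) u = ζ i u a * starSol β ξ i u b) :
    (∀ i : Fin N, ∀ u ∈ U, ∀ (a : Fin M) (b : Fin M'),
      pd i (fun v => Ωξζ v a b + Ωζξ v b a - ∑ k : Fin N, ξ k v a * ζ k v b) u = 0) ∧
    (∀ u ∈ U, ∀ v ∈ U, ∀ (a : Fin M) (b : Fin M'),
      Ωξζ u a b + Ωζξ u b a - ∑ k : Fin N, ξ k u a * ζ k u b
        = Ωξζ v a b + Ωζξ v b a - ∑ k : Fin N, ξ k v a * ζ k v b) := by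
  have hdiff : ∀ {f : (Fin N → ℝ) → ℝ}, ContDiffOn ℝ (⊤ : ℕ∞) f U →
      ∀ u ∈ U, DifferentiableAt ℝ f u := fun hf u hu =>
    (hf.differentiableOn (by simp)).differentiableAt (hUopen.mem_nhds hu)
  have hpd : ∀ i : Fin N, ∀ u ∈ U, ∀ (a : Fin M) (b : Fin M'),
      pd i (fun v => Ωξζ v a b + Ωζξ v b a - ∑ k : Fin N, ξ k v a * ζ k v b) u = 0 := by
    intro i u hu a b
    have hξ k := hdiff (hξsmooth k a) u hu
    have hζ k := hdiff (hζsmooth k b) u hu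
    rw [pd_potential_sub_sum i (hdiff (hΩξζsmooth a b) u hu) (hdiff (hΩζξsmooth b a) u hu)
      hξ hζ, hΩξζ i u hu, hΩζξ i u hu, ← Finset.add_sum_erase _ _ (Finset.mem_univ i),
      Finset.sum_congr rfl fun k hk => by
        rw [hξX i k (Finset.ne_of_mem_erase hk).symm u hu,
          hζX i k (Finset.ne_of_mem_erase hk).symm u hu]]
    simp only [starSol, mul_add, Finset.mul_sum, Finset.sum_add_distrib]
    have hξζ : ∑ k ∈ Finset.univ.erase i, ξ i u a * (ζ k u b * β k i u)
        = ∑ k ∈ Finset.univ.erase i, ζ k u b * (β k i u * ξ i u a) :=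
      Finset.sum_congr rfl fun k _ => by ring
    have hζξ : ∑ k ∈ Finset.univ.erase i, ζ i u b * (ξ k u a * β k i u)
        = ∑ k ∈ Finset.univ.erase i, ξ k u a * (β k i u * ζ i u b) :=
      Finset.sum_congr rfl fun k _ => by ring
    rw [hξζ, hζξ]
    ring
  refine ⟨hpd, fun u hu v hv a b => ?_⟩
  refine hUopen.is_const_of_fderiv_eq_zero (𝕜 := ℝ)
    (f := fun v => Ωξζ v a b + Ωζξ v b a - ∑ k : Fin N, ξ k v a * ζ k v b)
    hUconn.isPreconnected (fun w hw => ?_)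
    (fun w hw => fderiv_eq_zero_of_pd_eq_zero fun i => hpd i w hw a b) hu hv
  exact (((hdiff (hΩξζsmooth a b) w hw).add (hdiff (hΩζξsmooth b a) w hw)).sub
    (DifferentiableAt.fun_sum fun k _ =>
      (hdiff (hξsmooth k a) w hw).mul (hdiff (hζsmooth k b) w hw))).differentiableWithinAt
end

section
/- Let β_ij : U → ℝ (i ≠ j) be smooth on a nonempty open connected U ⊆ ℝ^N, and let X_i : U → ℝ^N (i = 1,…,N) be an X-solution for β such that for every u ∈ U the vectors X_1(u),…,X_N(u) form an orthonormal basis of ℝ^N. Let ξ_i : U → ℝ^M be an X-solution for β and set ξ*_i := (∂_i ξ_i + Σ_{k≠i} ξ_k β_ki)ᵀ. Then for every i = 1,…,N, ∂_i ( Σ_{k=1}^N X_k ξ_kᵀ ) = X_i ξ*_i (outer product of the column X_i with the row ξ*_i); that is, Σ_{k=1}^N X_k ξ_kᵀ is a potential Ω(X,ξ*) for the pair (X, ξ*). Equivalently, ξ_i = Ω(X,ξ*)ᵀ X_i. -/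
open Matrix Finset

/-- Leibniz rule for `Σ_k η_k ξ_kᵀ` when `η` and `ξ` are two X-solutions for the same `β`. -/
lemma pd_sum_mul_eq_starSol {N L M : ℕ} {β : Fin N → Fin N → (Fin N → ℝ) → ℝ}
    {η : Fin N → (Fin N → ℝ) → Fin L → ℝ} {ξ : Fin N → (Fin N → ℝ) → Fin M → ℝ}
    {u : Fin N → ℝ} {i : Fin N}
    (hηd : ∀ j a, DifferentiableAt ℝ (fun v => η j v a) u)
    (hξd : ∀ j b, DifferentiableAt ℝ (fun v => ξ j v b) u)
    (hη : ∀ j, i ≠ j → ∀ a, pd i (fun v => η j v a) u = β j i u * η i u a)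
    (hξ : ∀ j, i ≠ j → ∀ b, pd i (fun v => ξ j v b) u = β j i u * ξ i u b)
    (a : Fin L) (b : Fin M) :
    pd i (fun v => ∑ k, η k v a * ξ k v b) u =
      η i u a * starSol β ξ i u b + starSol β η i u a * ξ i u b := by
  have leibniz : pd i (fun v => ∑ k, η k v a * ξ k v b) u =
      ∑ k, (η k u a * pd i (fun v => ξ k v b) u + pd i (fun v => η k v a) u * ξ k u b) := by
    unfold pd
    rw [fderiv_fun_sum fun k _ => (hηd k a).fun_mul (hξd k b), _root_.sum_apply]
    refine Finset.sum_congr rfl fun k _ => ?_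
    rw [fderiv_fun_mul (hηd k a) (hξd k b)]
    simp [mul_comm]
  have off_diag : ∑ k ∈ Finset.univ.erase i,
        (η k u a * pd i (fun v => ξ k v b) u + pd i (fun v => η k v a) u * ξ k u b) =
      η i u a * ∑ k ∈ Finset.univ.erase i, ξ k u b * β k i u +
        (∑ k ∈ Finset.univ.erase i, η k u a * β k i u) * ξ i u b := by
    rw [Finset.mul_sum, Finset.sum_mul, ← Finset.sum_add_distrib]
    refine Finset.sum_congr rfl fun k hk => ?_
    have hik : i ≠ k := (Finset.ne_of_mem_erase hk).symm
    rw [hη k hik, hξ k hik]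
    ring
  rw [leibniz, ← Finset.add_sum_erase _ _ (Finset.mem_univ i), off_diag]
  unfold starSol
  ring

/-- If the rows of a square matrix are orthonormal, so are its columns. -/
lemma sum_mul_eq_ite_of_dotProduct_eq_ite {N : ℕ} {P : Fin N → Fin N → ℝ}
    (hP : ∀ k l, P k ⬝ᵥ P l = if k = l then (1 : ℝ) else 0) (a b : Fin N) :
    ∑ k, P k a * P k b = if a = b then (1 : ℝ) else 0 := by
  have row : Matrix.of P * (Matrix.of P)ᵀ = 1 := by
    ext k l
    simpa [Matrix.mul_apply, Matrix.one_apply, dotProduct] using hP k l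
  have col := congrArg (fun A => A a b) (mul_eq_one_comm.mp row)
  simpa [Matrix.mul_apply, Matrix.one_apply] using col

/-- If `x` is a unit vector and `x dᵀ + d xᵀ = 0`, then `d = 0`. -/
lemma eq_zero_of_symm_outer_eq_zero {ι : Type*} [Fintype ι] {x d : ι → ℝ}
    (hx : x ⬝ᵥ x = 1) (h : ∀ a b, x a * d b + d a * x b = 0) (a : ι) : d a = 0 := by
  have diag (b : ι) : d b * x b = 0 := by linarith [h b b]
  calc d a = ∑ b, d a * (x b * x b) := by
        rw [← Finset.mul_sum, show ∑ b, x b * x b = 1 from hx, mul_one]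
    _ = 0 := Finset.sum_eq_zero fun b _ => by linear_combination x b * h a b - x a * diag b

/-- For an orthonormal tangent frame `X` one has
`∂_i (Σ_k X_k ξ_kᵀ) = X_i ξ*_i`, i.e. `Σ_k X_k ξ_kᵀ` is a potential `Ω(X,ξ*)`; equivalently
`ξ_i = Ω(X,ξ*)ᵀ X_i`. -/
theorem stmt_16 {N M : ℕ} (hN : 2 ≤ N)
    (U : Set (Fin N → ℝ)) (hUopen : IsOpen U) (hUconn : IsConnected U)
    (β : Fin N → Fin N → (Fin N → ℝ) → ℝ)
    (hβsmooth : ∀ i j : Fin N, i ≠ j → ContDiffOn ℝ (⊤ : ℕ∞) (β i j) U)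
    (X : Fin N → (Fin N → ℝ) → Fin N → ℝ)
    (hXsmooth : ∀ (j : Fin N) (a : Fin N), ContDiffOn ℝ (⊤ : ℕ∞) (fun u => X j u a) U)
    (hXX : ∀ i j : Fin N, i ≠ j → ∀ u ∈ U, ∀ a : Fin N,
      pd i (fun v => X j v a) u = β j i u * X i u a)
    (hXortho : ∀ u ∈ U, ∀ k l : Fin N,
      X k u ⬝ᵥ X l u = if k = l then (1 : ℝ) else 0)
    (ξ : Fin N → (Fin N → ℝ) → Fin M → ℝ)
    (hξsmooth : ∀ (j : Fin N) (a : Fin M), ContDiffOn ℝ (⊤ : ℕ∞) (fun u => ξ j u a) U)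
    (hξX : ∀ i j : Fin N, i ≠ j → ∀ u ∈ U, ∀ a : Fin M,
      pd i (fun v => ξ j v a) u = β j i u * ξ i u a) :
    (∀ i : Fin N, ∀ u ∈ U, ∀ (a : Fin N) (b : Fin M),
      pd i (fun v => ∑ k : Fin N, X k v a * ξ k v b) u = X i u a * starSol β ξ i u b) ∧
    (∀ u ∈ U, ∀ (i : Fin N) (b : Fin M),
      ξ i u b = ∑ a : Fin N, (∑ k : Fin N, X k u a * ξ k u b) * X i u a) := by
  have hd {L : ℕ} {η : Fin N → (Fin N → ℝ) → Fin L → ℝ}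
      (hη : ∀ j a, ContDiffOn ℝ (⊤ : ℕ∞) (fun u => η j u a) U) {u : Fin N → ℝ} (hu : u ∈ U)
      (j : Fin N) (a : Fin L) : DifferentiableAt ℝ (fun v => η j v a) u :=
    ((hη j a).contDiffAt (hUopen.mem_nhds hu)).differentiableAt (by simp)
  have star_X (i : Fin N) (u : Fin N → ℝ) (hu : u ∈ U) (a : Fin N) : starSol β X i u a = 0 := by
    refine eq_zero_of_symm_outer_eq_zero (by simpa using hXortho u hu i i) (fun a b => ?_) a
    rw [← pd_sum_mul_eq_starSol (hd hXsmooth hu) (hd hXsmooth hu)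
      (fun j hj => hXX i j hj u hu) (fun j hj => hXX i j hj u hu)]
    have hconst : (fun v => ∑ k, X k v a * X k v b) =ᶠ[nhds u]
        fun _ => if a = b then (1 : ℝ) else 0 :=
      Filter.eventuallyEq_of_mem (hUopen.mem_nhds hu) fun v hv =>
        sum_mul_eq_ite_of_dotProduct_eq_ite (hXortho v hv) a b
    simp [pd, hconst.fderiv_eq]
  refine ⟨fun i u hu a b => ?_, fun u hu i b => ?_⟩
  · rw [pd_sum_mul_eq_starSol (hd hXsmooth hu) (hd hξsmooth hu)
      (fun j hj => hXX i j hj u hu) (fun j hj => hξX i j hj u hu), star_X i u hu]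
    ring
  · symm
    calc ∑ a, (∑ k, X k u a * ξ k u b) * X i u a
        = ∑ k, (X k u ⬝ᵥ X i u) * ξ k u b := by
          simp only [dotProduct, Finset.sum_mul]
          rw [Finset.sum_comm]
          exact Finset.sum_congr rfl fun k _ => Finset.sum_congr rfl fun a _ => by ring
      _ = ξ i u b := by simp [hXortho u hu]
end

section
/- (Vectorial symmetric Ribaucour transformation preserves the Darboux-Egoroff equations.) Let β_ij : U → ℝ (i ≠ j) satisfy the Darboux-Egoroff equations on a nonempty open connected U ⊆ ℝ^N: ∂_k β_ij = β_ik β_kj for pairwise distinct i,j,k; β_ij = β_ji for i ≠ j; and Σ_{k=1}^N ∂_k β_ij = 0 for i ≠ j. Let ξ_i : U → ℝ^M be an X-solution for β and L an M×M real matrix such that ξ_iᵀ L = (∂_i ξ_i + Σ_{k≠i} ξ_k β_ki)ᵀ for all i; set ξ*_i := ξ_iᵀ L. Let Ω := Ω(ξ,ξ*) be a potential satisfying Lᵀ Ω = Ωᵀ L and Ω + Ωᵀ = Σ_{k=1}^N ξ_k ξ_kᵀ on U, and assume Ω is invertible everywhere on U. Then the transformed rotation coefficients β̂_ij := β_ij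 − ξ*_j Ω⁻¹ ξ_i again satisfy the Darboux-Egoroff equations: ∂_k β̂_ij = β̂_ik β̂_kj for pairwise distinct i,j,k; β̂_ij = β̂_ji for i ≠ j; and Σ_{k=1}^N ∂_k β̂_ij = 0 for i ≠ j. -/
open Matrix Finset

/-- The function `f` is differentiable at `u` and its partial derivative has the given value. -/
def HasPD {N : ℕ} (k : Fin N) (f : (Fin N → ℝ) → ℝ) (f' : ℝ) (u : Fin N → ℝ) : Prop :=
  DifferentiableAt ℝ f u ∧ pd k f u = f'

namespace HasPD

variable {N M : ℕ} {k : Fin N} {u : Fin N → ℝ}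

theorem sub {f g : (Fin N → ℝ) → ℝ} {f' g' : ℝ} (hf : HasPD k f f' u) (hg : HasPD k g g' u) :
    HasPD k (fun v => f v - g v) (f' - g') u := by
  refine ⟨hf.1.sub hg.1, ?_⟩
  rw [← hf.2, ← hg.2]
  simp [pd, fderiv_fun_sub hf.1 hg.1]

theorem mul {f g : (Fin N → ℝ) → ℝ} {f' g' : ℝ} (hf : HasPD k f f' u) (hg : HasPD k g g' u) :
    HasPD k (fun v => f v * g v) (f' * g u + f u * g') u := by
  refine ⟨hf.1.mul hg.1, ?_⟩
  rw [← hf.2, ← hg.2]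
  simp [pd, fderiv_fun_mul hf.1 hg.1]
  ring

theorem const (c : ℝ) : HasPD k (fun _ => c) 0 u :=
  ⟨differentiableAt_const c, by simp [pd]⟩

theorem sum {f : Fin M → (Fin N → ℝ) → ℝ} {f' : Fin M → ℝ} (hf : ∀ a, HasPD k (f a) (f' a) u) :
    HasPD k (fun v => ∑ a, f a v) (∑ a, f' a) u := by
  refine ⟨DifferentiableAt.fun_sum fun a _ => (hf a).1, ?_⟩
  simp only [pd, fderiv_fun_sum fun a _ => (hf a).1, _root_.sum_apply]
  exact Finset.sum_congr rfl fun a _ => (hf a).2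

theorem dotProduct {x y : (Fin N → ℝ) → Fin M → ℝ} {x' y' : Fin M → ℝ}
    (hx : ∀ a, HasPD k (fun v => x v a) (x' a) u) (hy : ∀ a, HasPD k (fun v => y v a) (y' a) u) :
    HasPD k (fun v => x v ⬝ᵥ y v) (x' ⬝ᵥ y u + x u ⬝ᵥ y') u := by
  have h := sum fun a => (hx a).mul (hy a)
  rwa [Finset.sum_add_distrib] at h

theorem vecMul {x : (Fin N → ℝ) → Fin M → ℝ} {x' : Fin M → ℝ}
    {A : (Fin N → ℝ) → Matrix (Fin M) (Fin M) ℝ} {A' : Matrix (Fin M) (Fin M) ℝ}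
    (hx : ∀ a, HasPD k (fun v => x v a) (x' a) u)
    (hA : ∀ a b, HasPD k (fun v => A v a b) (A' a b) u) (b : Fin M) :
    HasPD k (fun v => (x v ᵥ* A v) b) ((x' ᵥ* A u + x u ᵥ* A') b) u :=
  dotProduct hx fun a => hA a b

attribute [local instance] Matrix.linftyOpNormedRing Matrix.linftyOpNormedAlgebra in
theorem inv {A : (Fin N → ℝ) → Matrix (Fin M) (Fin M) ℝ} {A' : Matrix (Fin M) (Fin M) ℝ}
    (hA : ∀ a b, HasPD k (fun v => A v a b) (A' a b) u) (hu : IsUnit (A u).det) (a b : Fin M) :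
    HasPD k (fun v => (A v)⁻¹ a b) ((-((A u)⁻¹ * A' * (A u)⁻¹)) a b) u := by
  have hd : HasFDerivAt A
      (ContinuousLinearMap.pi fun a => ContinuousLinearMap.pi fun b =>
        fderiv ℝ (fun v => A v a b) u) u :=
    hasFDerivAt_pi.2 fun a => hasFDerivAt_pi.2 fun b => (hA a b).1.hasFDerivAt
  obtain ⟨x, hx⟩ := (Matrix.isUnit_iff_isUnit_det (A u)).2 hu
  have hi := hasFDerivAt_ringInverse (𝕜 := ℝ) x
  rw [hx] at hi
  have hr := hasFDerivAt_pi'.1 (hi.comp u hd) a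
  have hc := hasFDerivAt_pi'.1 hr b
  have hxi : ((x⁻¹ : (Matrix (Fin M) (Fin M) ℝ)ˣ) : Matrix (Fin M) (Fin M) ℝ) = (A u)⁻¹ := by
    rw [← hx, Matrix.coe_units_inv]
  have hA' : (fun a b => fderiv ℝ (fun v => A v a b) u (Pi.single k 1)) = A' :=
    funext fun a => funext fun b => (hA a b).2
  simp only [Function.comp_def, ← Matrix.nonsing_inv_eq_ringInverse] at hc
  refine ⟨hc.differentiableAt, ?_⟩
  rw [pd, hc.fderiv, ← hxi, ← hA']
  rfl

end HasPD

/-- Derivative of `ξ_jᵀ L Ω⁻¹ ξ_i` when `∂_k Ω = z (zᵀ L)`. -/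
theorem hasPD_bilin_inv {N M : ℕ} {k : Fin N} {u : Fin N → ℝ}
    {x y : (Fin N → ℝ) → Fin M → ℝ} {x' y' z : Fin M → ℝ}
    {L : Matrix (Fin M) (Fin M) ℝ} {A : (Fin N → ℝ) → Matrix (Fin M) (Fin M) ℝ}
    (hx : ∀ a, HasPD k (fun v => x v a) (x' a) u) (hy : ∀ a, HasPD k (fun v => y v a) (y' a) u)
    (hA : ∀ a b, HasPD k (fun v => A v a b) (z a * (z ᵥ* L) b) u) (hu : IsUnit (A u).det) :
    HasPD k (fun v => ((x v ᵥ* L) ᵥ* (A v)⁻¹) ⬝ᵥ y v)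
      ((x' ᵥ* (L * (A u)⁻¹)) ⬝ᵥ y u + (x u ᵥ* (L * (A u)⁻¹)) ⬝ᵥ y'
        - ((x u ᵥ* (L * (A u)⁻¹)) ⬝ᵥ z) * ((z ᵥ* (L * (A u)⁻¹)) ⬝ᵥ y u)) u := by
  have hxL : ∀ b, HasPD k (fun v => (x v ᵥ* L) b) ((x' ᵥ* L) b) u := fun b => by
    have h := HasPD.vecMul hx (A := fun _ => L) (A' := 0) (fun a b => HasPD.const (L a b)) b
    simpa using h
  have hinv := HasPD.inv (A' := vecMulVec z (z ᵥ* L)) hA hu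
  convert HasPD.dotProduct (HasPD.vecMul hxL hinv) hy using 1
  simp only [Matrix.vecMul_neg, ← Matrix.vecMul_vecMul, Matrix.vecMul_vecMulVec,
    Matrix.smul_vecMul, add_dotProduct, neg_dotProduct, smul_dotProduct, smul_eq_mul]
  ring

/-- `L Ω⁻¹` is symmetric as soon as `Lᵀ Ω` is. -/
theorem isSymm_mul_inv {M : ℕ} {L A : Matrix (Fin M) (Fin M) ℝ} (h : Lᵀ * A = Aᵀ * L)
    (hA : IsUnit A.det) : (L * A⁻¹).IsSymm := by
  have hAt : IsUnit Aᵀ.det := by rwa [Matrix.det_transpose]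
  rw [Matrix.IsSymm, Matrix.transpose_mul, Matrix.transpose_nonsing_inv]
  calc Aᵀ⁻¹ * Lᵀ = Aᵀ⁻¹ * (Lᵀ * A) * A⁻¹ := by
        rw [Matrix.mul_assoc, Matrix.mul_assoc, Matrix.mul_nonsing_inv _ hA, Matrix.mul_one]
    _ = L * A⁻¹ := by rw [h, ← Matrix.mul_assoc, Matrix.nonsing_inv_mul _ hAt, Matrix.one_mul]

/-- Symmetric matrices give symmetric bilinear forms. -/
theorem vecMul_dotProduct_comm_of_isSymm {M : ℕ} {S : Matrix (Fin M) (Fin M) ℝ} (hS : S.IsSymm)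
    (x y : Fin M → ℝ) : (x ᵥ* S) ⬝ᵥ y = (y ᵥ* S) ⬝ᵥ x := by
  rw [← Matrix.dotProduct_mulVec, ← Matrix.vecMul_transpose, hS.eq, dotProduct_comm]

/-- If `Lᵀ A` is symmetric, then `S = L A⁻¹` satisfies `S (A + Aᵀ) S = L S + S Lᵀ`. -/
theorem mul_inv_conj_add_transpose {M : ℕ} {L A : Matrix (Fin M) (Fin M) ℝ}
    (h : Lᵀ * A = Aᵀ * L) (hA : IsUnit A.det) :
    L * A⁻¹ * (A + Aᵀ) * (L * A⁻¹) = L * (L * A⁻¹) + L * A⁻¹ * Lᵀ := by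
  have h1 : L * A⁻¹ * A = L := by
    rw [Matrix.mul_assoc, Matrix.nonsing_inv_mul _ hA, Matrix.mul_one]
  have h2 : Aᵀ * (L * A⁻¹) = Lᵀ := by
    rw [← Matrix.mul_assoc, ← h, Matrix.mul_assoc, Matrix.mul_nonsing_inv _ hA, Matrix.mul_one]
  rw [Matrix.mul_add, Matrix.add_mul, h1, Matrix.mul_assoc (L * A⁻¹), h2]

/-- The vectorial symmetric Ribaucour transformation
`β̂_ij := β_ij − ξ*_j Ω⁻¹ ξ_i` preserves the Darboux-Egoroff equations. -/
theorem stmt_18 {N M : ℕ} (hN : 2 ≤ N)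
    (U : Set (Fin N → ℝ)) (hUopen : IsOpen U) (hUconn : IsConnected U)
    (β : Fin N → Fin N → (Fin N → ℝ) → ℝ)
    (hβsmooth : ∀ i j : Fin N, i ≠ j → ContDiffOn ℝ (⊤ : ℕ∞) (β i j) U)
    (hDarboux : ∀ i j k : Fin N, i ≠ j → j ≠ k → i ≠ k → ∀ u ∈ U,
      pd k (β i j) u = β i k u * β k j u)
    (hβsym : ∀ i j : Fin N, i ≠ j → ∀ u ∈ U, β i j u = β j i u)
    (hEgoroff : ∀ i j : Fin N, i ≠ j → ∀ u ∈ U, ∑ k : Fin N, pd k (β i j) u = 0)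
    (ξ : Fin N → (Fin N → ℝ) → Fin M → ℝ)
    (hξsmooth : ∀ (j : Fin N) (a : Fin M), ContDiffOn ℝ (⊤ : ℕ∞) (fun u => ξ j u a) U)
    (hξX : ∀ i j : Fin N, i ≠ j → ∀ u ∈ U, ∀ a : Fin M,
      pd i (fun v => ξ j v a) u = β j i u * ξ i u a)
    (L : Matrix (Fin M) (Fin M) ℝ)
    (hL : ∀ i : Fin N, ∀ u ∈ U, ξ i u ᵥ* L = starSol β ξ i u)
    (Ω : (Fin N → ℝ) → Matrix (Fin M) (Fin M) ℝ)
    (hΩsmooth : ∀ (a b : Fin M), ContDiffOn ℝ (⊤ : ℕ∞) (fun u => Ω u a b) U)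
    (hΩpot : ∀ i : Fin N, ∀ u ∈ U, ∀ (a b : Fin M),
      pd i (fun v => Ω v a b) u = ξ i u a * (ξ i u ᵥ* L) b)
    (hΩconstr1 : ∀ u ∈ U, Lᵀ * Ω u = (Ω u)ᵀ * L)
    (hΩconstr2 : ∀ u ∈ U, ∀ (a b : Fin M),
      Ω u a b + Ω u b a = ∑ k : Fin N, ξ k u a * ξ k u b)
    (hΩinv : ∀ u ∈ U, IsUnit (Ω u).det) :
    (∀ i j k : Fin N, i ≠ j → j ≠ k → i ≠ k → ∀ u ∈ U,
      pd k (fun v => β i j v - ((ξ j v ᵥ* L) ᵥ* (Ω v)⁻¹) ⬝ᵥ ξ i v) u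
        = (β i k u - ((ξ k u ᵥ* L) ᵥ* (Ω u)⁻¹) ⬝ᵥ ξ i u)
          * (β k j u - ((ξ j u ᵥ* L) ᵥ* (Ω u)⁻¹) ⬝ᵥ ξ k u)) ∧
    (∀ i j : Fin N, i ≠ j → ∀ u ∈ U,
      β i j u - ((ξ j u ᵥ* L) ᵥ* (Ω u)⁻¹) ⬝ᵥ ξ i u
        = β j i u - ((ξ i u ᵥ* L) ᵥ* (Ω u)⁻¹) ⬝ᵥ ξ j u) ∧
    (∀ i j : Fin N, i ≠ j → ∀ u ∈ U,
      ∑ k : Fin N, pd k (fun v => β i j v - ((ξ j v ᵥ* L) ᵥ* (Ω v)⁻¹) ⬝ᵥ ξ i v) u = 0) := by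
  have diff {f : (Fin N → ℝ) → ℝ} (hf : ContDiffOn ℝ (⊤ : ℕ∞) f U) {u} (hu : u ∈ U) :
      DifferentiableAt ℝ f u :=
    (hf.contDiffAt (hUopen.mem_nhds hu)).differentiableAt (by simp)
  have hS u (hu : u ∈ U) := isSymm_mul_inv (hΩconstr1 u hu) (hΩinv u hu)
  have key (i j k : Fin N) (hij : i ≠ j) (u) (hu : u ∈ U) :=
    (HasPD.sub (k := k) ⟨diff (hβsmooth i j hij) hu, rfl⟩
      (hasPD_bilin_inv (fun a => ⟨diff (hξsmooth j a) hu, rfl⟩)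
        (fun a => ⟨diff (hξsmooth i a) hu, rfl⟩)
        (fun a b => ⟨diff (hΩsmooth a b) hu, hΩpot k u hu a b⟩) (hΩinv u hu))).2
  refine ⟨fun i j k hij hjk hik u hu => ?_, fun i j hij u hu => ?_, fun i j hij u hu => ?_⟩
  · rw [key i j k hij u hu, hDarboux i j k hij hjk hik u hu]
    have hX (l : Fin N) (hl : k ≠ l) :
        (fun a => pd k (fun v => ξ l v a) u) = β l k u • ξ k u :=
      funext fun a => hξX k l hl u hu a
    rw [hX j hjk.symm, hX i hik.symm, hβsym j k hjk u hu]
    simp only [← Matrix.vecMul_vecMul, Matrix.smul_vecMul, smul_dotProduct, dotProduct_smul,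
      smul_eq_mul]
    ring
  · simp only [Matrix.vecMul_vecMul]
    rw [hβsym i j hij u hu, vecMul_dotProduct_comm_of_isSymm (hS u hu)]
  · have hsum (l : Fin N) : ∑ k, (fun a => pd k (fun v => ξ l v a) u) = ξ l u ᵥ* L := by
      rw [hL l u hu]
      ext a
      rw [Finset.sum_apply, starSol, ← Finset.add_sum_erase _ _ (Finset.mem_univ l)]
      congr 1
      refine Finset.sum_congr rfl fun k hk => ?_
      have hkl := Finset.ne_of_mem_erase hk
      rw [hξX k l hkl u hu a, hβsym l k hkl.symm u hu, mul_comm]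
    have hG : ∑ k, vecMulVec (ξ k u) (ξ k u) = Ω u + (Ω u)ᵀ := by
      ext a b
      simp [Matrix.sum_apply, vecMulVec_apply, hΩconstr2 u hu a b]
    simp only [key i j _ hij u hu, Finset.sum_sub_distrib, Finset.sum_add_distrib]
    rw [hEgoroff i j hij u hu]
    have hconj := mul_inv_conj_add_transpose (hΩconstr1 u hu) (hΩinv u hu)
    generalize L * (Ω u)⁻¹ = S at hconj ⊢
    have h1 : ∑ k, ((fun a => pd k (fun v => ξ j v a) u) ᵥ* S) ⬝ᵥ ξ i u
        = (ξ j u ᵥ* (L * S)) ⬝ᵥ ξ i u := by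
      rw [← sum_dotProduct, ← Matrix.sum_vecMul, hsum, Matrix.vecMul_vecMul]
    have h2 : ∑ k, (ξ j u ᵥ* S) ⬝ᵥ (fun a => pd k (fun v => ξ i v a) u)
        = (ξ j u ᵥ* (S * Lᵀ)) ⬝ᵥ ξ i u := by
      rw [← dotProduct_sum, hsum, ← Matrix.vecMul_vecMul, ← Matrix.dotProduct_mulVec (ξ j u ᵥ* S),
        Matrix.mulVec_transpose]
    have h3 : ∑ k, ((ξ j u ᵥ* S) ⬝ᵥ ξ k u) * ((ξ k u ᵥ* S) ⬝ᵥ ξ i u)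
        = (ξ j u ᵥ* (S * (Ω u + (Ω u)ᵀ) * S)) ⬝ᵥ ξ i u := by
      rw [← hG, ← Matrix.vecMul_vecMul, ← Matrix.vecMul_vecMul, Matrix.vecMul_sum,
        Matrix.sum_vecMul, sum_dotProduct]
      simp only [Matrix.vecMul_vecMulVec, Matrix.smul_vecMul, smul_dotProduct, smul_eq_mul]
    rw [h1, h2, h3, hconj, Matrix.vecMul_add, add_dotProduct]
    ring
end

section
/- (The Ribaucour transformation preserves orthonormality of the tangent frame.) Let x_1,…,x_N be an orthonormal basis of ℝ^N, let a_1,…,a_N ∈ ℝ^M, and let Ω be an invertible real M×M matrix satisfying Ω + Ωᵀ = Σ_{k=1}^N a_k a_kᵀ. Define x̂_i := x_i − Σ_{k=1}^N x_k (a_kᵀ Ω⁻¹ a_i) for i = 1,…,N. Then x̂_1,…,x̂_N is again an orthonormal system: x̂_i · x̂_j = δ_ij for all i,j. -/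
open Matrix Finset

/-- If `Ω + Ωᵀ = Σ_k a_k a_kᵀ`, then the Gram form `Σ_k (a_k · v) (a_k · w)` is the
symmetrization of the bilinear form of `Ω`. -/
theorem sum_dotProduct_mul_dotProduct_of_add_transpose_eq {N M : ℕ}
    (a : Fin N → Fin M → ℝ) (Ω : Matrix (Fin M) (Fin M) ℝ)
    (hΩ : Ω + Ωᵀ = ∑ k : Fin N, vecMulVec (a k) (a k)) (v w : Fin M → ℝ) :
    ∑ k, (a k ⬝ᵥ v) * (a k ⬝ᵥ w) = v ⬝ᵥ (Ω *ᵥ w) + w ⬝ᵥ (Ω *ᵥ v) := by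
  have hleft : v ⬝ᵥ ((Ω + Ωᵀ) *ᵥ w) = v ⬝ᵥ (Ω *ᵥ w) + w ⬝ᵥ (Ω *ᵥ v) := by
    rw [add_mulVec, dotProduct_add, mulVec_transpose, dotProduct_comm v (w ᵥ* Ω),
      ← dotProduct_mulVec]
  rw [← hleft, hΩ, sum_mulVec, dotProduct_sum]
  refine Finset.sum_congr rfl fun k _ => ?_
  rw [vecMulVec_mulVec, op_smul_eq_smul, dotProduct_smul, smul_eq_mul, dotProduct_comm v,
    mul_comm]

/-- Inner products of the vectors `x_i - Σ_k c_k x_k` in an orthonormal system. -/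
theorem sub_sum_smul_dotProduct_sub_sum_smul {N : ℕ} (x : Fin N → Fin N → ℝ)
    (hx : ∀ i j : Fin N, x i ⬝ᵥ x j = if i = j then (1 : ℝ) else 0)
    (c d : Fin N → ℝ) (i j : Fin N) :
    (x i - ∑ k, c k • x k) ⬝ᵥ (x j - ∑ k, d k • x k)
      = (if i = j then (1 : ℝ) else 0) - d i - c j + ∑ k, c k * d k := by
  simp only [sub_dotProduct, dotProduct_sub, mul_sub, Finset.sum_sub_distrib, sum_dotProduct,
    dotProduct_sum, smul_dotProduct,
    dotProduct_smul, hx, smul_eq_mul, mul_ite, mul_one, mul_zero, Finset.sum_ite_eq,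
    Finset.sum_ite_eq', Finset.mem_univ, if_true, mul_comm (d _) (c _)]
  ring

/-- The Ribaucour transformation preserves orthonormality of the tangent frame:
if `x_1, …, x_N` is orthonormal, `Ω + Ωᵀ = Σ_k a_k a_kᵀ` with `Ω` invertible, then
`x̂_i := x_i − Σ_k x_k (a_kᵀ Ω⁻¹ a_i)` is again an orthonormal system. -/
theorem stmt_19 {N M : ℕ}
    (x : Fin N → Fin N → ℝ)
    (hxortho : ∀ i j : Fin N, x i ⬝ᵥ x j = if i = j then (1 : ℝ) else 0)
    (a : Fin N → Fin M → ℝ)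
    (Ω : Matrix (Fin M) (Fin M) ℝ)
    (hΩinv : IsUnit Ω.det)
    (hΩ : Ω + Ωᵀ = ∑ k : Fin N, vecMulVec (a k) (a k)) :
    ∀ i j : Fin N,
      (x i - ∑ k : Fin N, (a k ⬝ᵥ (Ω⁻¹ *ᵥ a i)) • x k)
        ⬝ᵥ (x j - ∑ k : Fin N, (a k ⬝ᵥ (Ω⁻¹ *ᵥ a j)) • x k)
        = if i = j then (1 : ℝ) else 0 := by
  intro i j
  have hΩmul (b : Fin M → ℝ) : Ω *ᵥ (Ω⁻¹ *ᵥ b) = b := by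
    rw [mulVec_mulVec, mul_nonsing_inv _ hΩinv, one_mulVec]
  rw [sub_sum_smul_dotProduct_sub_sum_smul x hxortho,
    sum_dotProduct_mul_dotProduct_of_add_transpose_eq a Ω hΩ, hΩmul, hΩmul,
    dotProduct_comm (a i), dotProduct_comm (a j)]
  ring
end
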